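/- arXiv:1208.2185 — 2 statements merged into one kernel-verified Lean document; each statement's English description precedes it below -/
import Mathlib

section
/- Every polynomial identity of M11(E) in two variables, i.e. every f in the free unital associative algebra K<x,y> such that phi(f) = 0 for every K-algebra homomorphism phi from K<x,y> to M11(E), belongs to the T-ideal of K<x,y> generated by the polynomial [[x,y]^2, x] together with the polynomials [x,y]^2 [x,y,x^(l)] for all l >= 0. -/
noncomputable section

open CliffordAlgebra

/-- The Grassmann algebra of an infinite-dimensional vector space (free on countably many
generators), with its even part `evenOdd 0 0` and odd part `evenOdd 0 1`. -/
abbrev GrassmannAlg (K : Type*) [Field K] := ExteriorAlgebra K (ℕ →₀ K)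

/-- `M11(E)`: the subalgebra of 2×2 matrices over the Grassmann algebra `E` whose diagonal
entries are even and whose off-diagonal entries are odd. -/
def M11 (K : Type*) [Field K] :
    Subalgebra K (Matrix (Fin 2) (Fin 2) (GrassmannAlg K)) where
  carrier := {A | A 0 0 ∈ evenOdd (0 : QuadraticForm K (ℕ →₀ K)) 0 ∧
                  A 1 1 ∈ evenOdd (0 : QuadraticForm K (ℕ →₀ K)) 0 ∧
                  A 0 1 ∈ evenOdd (0 : QuadraticForm K (ℕ →₀ K)) 1 ∧
                  A 1 0 ∈ evenOdd (0 : QuadraticForm K (ℕ →₀ K)) 1}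
  add_mem' := by
    rintro A B ⟨h1, h2, h3, h4⟩ ⟨g1, g2, g3, g4⟩
    exact ⟨add_mem h1 g1, add_mem h2 g2, add_mem h3 g3, add_mem h4 g4⟩
  mul_mem' := by
    rintro A B ⟨h1, h2, h3, h4⟩ ⟨g1, g2, g3, g4⟩
    have e00 : ((0 : ZMod 2) + 0) = 0 := by decide
    have e11 : ((1 : ZMod 2) + 1) = 0 := by decide
    have e01 : ((0 : ZMod 2) + 1) = 1 := by decide
    have e10 : ((1 : ZMod 2) + 0) = 1 := by decide
    refine ⟨?_, ?_, ?_, ?_⟩ <;>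
      simp only [Set.mem_setOf_eq, Matrix.mul_apply, Fin.sum_univ_two]
    · exact add_mem (e00 ▸ SetLike.mul_mem_graded h1 g1)
        (e11 ▸ SetLike.mul_mem_graded h3 g4)
    · exact add_mem (e11 ▸ SetLike.mul_mem_graded h4 g3)
        (e00 ▸ SetLike.mul_mem_graded h2 g2)
    · exact add_mem (e01 ▸ SetLike.mul_mem_graded h1 g3)
        (e10 ▸ SetLike.mul_mem_graded h3 g2)
    · exact add_mem (e10 ▸ SetLike.mul_mem_graded h4 g1)
        (e01 ▸ SetLike.mul_mem_graded h2 g4)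
  algebraMap_mem' := by
    intro r
    refine ⟨?_, ?_, ?_, ?_⟩ <;>
      simp only [Set.mem_setOf_eq, Matrix.algebraMap_matrix_apply]
    · simpa using SetLike.algebraMap_mem_graded (evenOdd (0 : QuadraticForm K (ℕ →₀ K))) r
    · simpa using SetLike.algebraMap_mem_graded (evenOdd (0 : QuadraticForm K (ℕ →₀ K))) r
    · simp [zero_mem (evenOdd (0 : QuadraticForm K (ℕ →₀ K)) 1)]
    · simp [zero_mem (evenOdd (0 : QuadraticForm K (ℕ →₀ K)) 1)]

/-- The commutator `[a,b] = a*b - b*a`. -/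
def br {A : Type*} [Ring A] (a b : A) : A := a * b - b * a

/-- `adIter c l z` is the left-normed commutator `[z, c^{(l)}] = [z, c, ..., c]`
with `l` occurrences of `c`. -/
def adIter {A : Type*} [Ring A] (c : A) (l : ℕ) (z : A) : A :=
  (fun w => w * c - c * w)^[l] z

/-- The generator `x` of the free unital associative algebra `K⟨x,y⟩`. -/
def xvar (K : Type*) [Field K] : FreeAlgebra K (Fin 2) := FreeAlgebra.ι K 0

/-- The generator `y` of the free unital associative algebra `K⟨x,y⟩`. -/
def yvar (K : Type*) [Field K] : FreeAlgebra K (Fin 2) := FreeAlgebra.ι K 1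

/-- The T-ideal of `K⟨x,y⟩` generated by a set `S`: the two-sided ideal generated by all
images of elements of `S` under unital `K`-algebra endomorphisms of `K⟨x,y⟩`. -/
def TIdealGen₂ (K : Type*) [Field K] (S : Set (FreeAlgebra K (Fin 2))) :
    TwoSidedIdeal (FreeAlgebra K (Fin 2)) :=
  TwoSidedIdeal.span
    {g | ∃ f ∈ S, ∃ φ : FreeAlgebra K (Fin 2) →ₐ[K] FreeAlgebra K (Fin 2), g = φ f}

/-- The set of polynomial identities in two variables of a unital associative `K`-algebra `A`:
all elements of `K⟨x,y⟩` killed by every unital `K`-algebra homomorphism into `A`. -/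
def polyIdentities₂ (K : Type*) [Field K] (A : Type*) [Ring A] [Algebra K A] :
    Set (FreeAlgebra K (Fin 2)) :=
  {f | ∀ φ : FreeAlgebra K (Fin 2) →ₐ[K] A, φ f = 0}


def SS {A : Type*} [Ring A] (z k : A) : Prop := (∀ b, k * b = b * k) ∧ k * z = 0

section
variable {A : Type*} [Ring A] {x y z : A}

def wd (x y : A) (l : List Bool) : A := (l.map (fun b => if b then x else y)).prod

lemma wd_app (x y : A) (l : List Bool) (t : Bool) :
    wd x y (l ++ [t]) = wd x y l * (if t then x else y) := by
  simp [wd]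

lemma wd_cons (x y : A) (l : List Bool) (t : Bool) :
    wd x y (t :: l) = (if t then x else y) * wd x y l := by
  simp [wd]

structure Hyp (x y z : A) : Prop where
  hz : z = x * y - y * x
  two : ∀ a : A, a + a = 0 → a = 0
  g : ∀ p q : A, br (br p q ^ 2) p = 0
  z3 : z ^ 3 = 0
  gen : ∀ k : A, (∀ c, k * c = c * k) → k * z = 0 → ∀ b, k * b * x = x * (k * b) ∧ k * b * y = y * (k * b)
  cen : ∀ k : A, k * x = x * k → k * y = y * k → ∀ b, k * b = b * k

lemma SS.add {k l : A} (h : SS z k) (h' : SS z l) : SS z (k + l) :=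
  ⟨fun b => by rw [add_mul, mul_add, h.1, h'.1], by rw [add_mul, h.2, h'.2, add_zero]⟩

lemma SS.neg {k : A} (h : SS z k) : SS z (-k) :=
  ⟨fun b => by rw [neg_mul, mul_neg, h.1], by rw [neg_mul, h.2, neg_zero]⟩

lemma SS.zero : SS z (0 : A) := ⟨by simp, by simp⟩

lemma SS.mulr (H : Hyp x y z) {k : A} (h : SS z k) (b : A) : SS z (k * b) :=
  ⟨fun c => H.cen _ (H.gen k h.1 h.2 b).1 (H.gen k h.1 h.2 b).2 c, by
    rw [h.1, mul_assoc, h.2, mul_zero]⟩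

lemma SS.mull (H : Hyp x y z) {k : A} (h : SS z k) (b : A) : SS z (b * k) := by
  rw [← h.1]; exact h.mulr H b

lemma Hyp.z2 (H : Hyp x y z) : SS z (z ^ 2) := by
  refine ⟨H.cen _ ?_ ?_, by rw [← pow_succ]; exact H.z3⟩
  · have := H.g x y
    rw [br, br, ← H.hz] at this
    exact sub_eq_zero.1 this
  · have := H.g y x
    have e : br y x = -z := by rw [br, H.hz]; abel
    rw [e, br, neg_sq] at this
    exact sub_eq_zero.1 this

/-- the central elements z∘[w,y] -/
lemma Hyp.cc (H : Hyp x y z) (w b : A) :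
    (z * (w * y - y * w) + (w * y - y * w) * z) * b
      = b * (z * (w * y - y * w) + (w * y - y * w) * z) := by
  apply H.cen
  · have h1 := H.g (x + w) y
    have h2 := H.g (x - w) y
    have h3 := H.g w y
    have h4 := H.z2.1 w
    apply sub_eq_zero.1
    apply H.two
    have : br (br (x + w) y ^ 2) (x + w) - br (br (x - w) y ^ 2) (x - w)
      - (br (br w y ^ 2) w + br (br w y ^ 2) w) - ((z ^ 2 * w - w * z ^ 2) + (z ^ 2 * w - w * z ^ 2)) = 0 := by
      rw [h1, h2, h3, h4]; simp
    rw [← this, H.hz]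
    unfold br
    noncomm_ring
  · have h1 := H.g y (x + w)
    have h2 := H.g y x
    have h3 := H.g y w
    apply sub_eq_zero.1
    have : br (br y (x + w) ^ 2) y - br (br y x ^ 2) y - br (br y w ^ 2) y = 0 := by
      rw [h1, h2, h3]; simp
    rw [← this, H.hz]
    unfold br
    noncomm_ring

lemma Hyp.lemE (H : Hyp x y z) (a : A) (t : Bool) (u : List Bool) :
    (∀ v : List Bool, v.length < u.length → SS z (z * a * wd x y v * z)) →
    SS z (z * a * (wd x y u * (if t then x else y) - (if t then x else y) * wd x y u)) := by
  induction u using List.reverseRecOn with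
  | nil => intro _; simpa [wd] using SS.zero
  | append_singleton u s ih =>
    intro h
    have h1 := (ih (fun v hv => h v (by simp; omega))).mulr H (if s then x else y)
    have h2 := h u (by simp)
    rw [wd_app]
    have hz := H.hz
    have key : SS z (z * a * wd x y u * ((if s then x else y) * (if t then x else y) -
        (if t then x else y) * (if s then x else y))) := by
      cases s <;> cases t <;> simp
      · exact SS.zero
      · have e : y * x - x * y = - z := by rw [hz]; abel
        rw [e, mul_neg]; exact h2.neg
      · rw [← hz]; exact h2
      · exact SS.zero
    convert h1.add key using 1
    noncomm_ring

lemma Hyp.good (H : Hyp x y z) (d : ℕ) :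
    ∀ l : List Bool, l.length ≤ d → SS z (z * wd x y l * z) := by
  induction d with
  | zero =>
    intro l hl
    have : l = [] := by simpa using hl
    subst this
    have := H.z2
    rw [pow_two] at this
    simpa [wd] using this
  | succ d IH =>
    intro l hl
    rcases List.eq_nil_or_concat l with rfl | ⟨u, t, rfl⟩
    · exact IH _ (by simp)
    rw [List.concat_eq_append] at hl ⊢
    have hu : u.length ≤ d := by simpa using hl
    set w := wd x y (u ++ [t]) with hw
    -- it suffices that it is central
    suffices hc : ∀ b, (z * w * z) * b = b * (z * w * z) by
      refine ⟨hc, ?_⟩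
      have e := H.z2.1 w
      have e3 := H.z3
      calc z * w * z * z = z * (w * z ^ 2) := by noncomm_ring
        _ = z ^ 3 * w := by rw [← e]; noncomm_ring
        _ = 0 := by rw [e3, zero_mul]
    have E1 : SS z (z * (w * y - y * w)) := by
      have := H.lemE 1 false (u ++ [t]) (fun v hv => by
        rw [mul_one]; exact IH v (by simp at hv; omega))
      simpa using this
    have hcz : z * (w * y - y * w) * z = 0 := E1.2
    have Sc : SS z (z * (w * y - y * w) + (w * y - y * w) * z) := by
      refine ⟨H.cc w, ?_⟩
      rw [H.cc w, mul_add, ← E1.1, hcz, ← mul_assoc, hcz, add_zero]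
    have E2 : SS z (z * x * (wd x y u * y - y * wd x y u)) := by
      have := H.lemE x false u (fun v hv => by
        have := IH (true :: v) (by simp; omega)
        rw [wd_cons] at this
        simpa [mul_assoc] using this)
      simpa using this
    have E3 : SS z (z * (wd x y u * x - x * wd x y u)) := by
      have := H.lemE 1 true u (fun v hv => by
        rw [mul_one]; exact IH v (by omega))
      simpa using this
    have c1 := H.cc (x * w)
    have c2 := (H.z2.mulr H w)
    have c3 := Sc.mull H x
    have c4 := E1.mull H x
    have c234 := (c2.add c3).add c4.neg
    cases t with
    | false =>
      have c5 := E2.mulr H y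
      have hwu : w = wd x y u * y := by rw [hw, wd_app]; simp
      have c := c234.add c5
      intro b
      have c1 := c1 b
      have c := c.1 b
      have : z * w * z = (z * (x * w * y - y * (x * w)) + (x * w * y - y * (x * w)) * z)
          - (z ^ 2 * w + x * (z * (w * y - y * w) + (w * y - y * w) * z) +
            -(x * (z * (w * y - y * w))) + z * x * (wd x y u * y - y * wd x y u) * y) := by
        rw [hwu, H.hz]; noncomm_ring
      rw [this, sub_mul, c1, c, ← mul_sub]
    | true =>
      have c5 := E2.mulr H x
      have c6 := E3.mulr H z
      have hwu : w = wd x y u * x := by rw [hw, wd_app]; simp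
      have c := (c234.add c5).add c6.neg
      intro b
      have c1 := c1 b
      have c := c.1 b
      have : z * w * z + z * w * z = (z * (x * w * y - y * (x * w)) + (x * w * y - y * (x * w)) * z)
          - (z ^ 2 * w + x * (z * (w * y - y * w) + (w * y - y * w) * z) +
            -(x * (z * (w * y - y * w))) + z * x * (wd x y u * y - y * wd x y u) * x +
            -(z * (wd x y u * x - x * wd x y u) * z)) := by
        rw [hwu, H.hz]; noncomm_ring
      have h2 : (z * w * z + z * w * z) * b = b * (z * w * z + z * w * z) := by
        rw [this, sub_mul, c1, c, ← mul_sub]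
      apply sub_eq_zero.1
      apply H.two
      rw [add_mul, mul_add] at h2
      have := sub_eq_zero.2 h2
      rw [← this]; abel

lemma Hyp.goodxy (H : Hyp x y z) (i j : ℕ) : SS z (z * (x ^ i * y ^ j) * z) := by
  have := H.good _ (List.replicate i true ++ List.replicate j false) le_rfl
  simpa [wd] using this

def m1 (x y : A) (s : Fin 2 →₀ ℕ) : A := x ^ s 0 * y ^ s 1
def m2 (x y z : A) (s : Fin 4 →₀ ℕ) : A := x ^ s 0 * (y ^ s 1 * (z * (x ^ s 2 * y ^ s 3)))
def m3 (x y z : A) (s : Fin 4 →₀ ℕ) : A := z * (x ^ s 0 * y ^ s 1) * z * (x ^ s 2 * y ^ s 3)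

lemma Hyp.span_top {K : Type*} [Field K] [Algebra K A] (H : Hyp x y z)
    (hadj : Algebra.adjoin K {x, y} = ⊤) :
    Submodule.span K (Set.range (m1 x y) ∪ (Set.range (m2 x y z) ∪ Set.range (m3 x y z))) = ⊤ := by
  set N := Submodule.span K (Set.range (m1 x y) ∪ (Set.range (m2 x y z) ∪ Set.range (m3 x y z)))
    with hN
  have h1 : ∀ a b, x ^ a * y ^ b ∈ N := fun a b => Submodule.subset_span
    (Or.inl ⟨Finsupp.equivFunOnFinite.symm ![a, b], by simp [m1]⟩)
  have h2 : ∀ a b c d, x ^ a * (y ^ b * (z * (x ^ c * y ^ d))) ∈ N := fun a b c d =>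
    Submodule.subset_span
      (Or.inr (Or.inl ⟨Finsupp.equivFunOnFinite.symm ![a, b, c, d], by simp [m2]⟩))
  have h3 : ∀ a b c d, z * (x ^ a * y ^ b) * z * (x ^ c * y ^ d) ∈ N := fun a b c d =>
    Submodule.subset_span
      (Or.inr (Or.inr ⟨Finsupp.equivFunOnFinite.symm ![a, b, c, d], by simp [m3]⟩))
  have hx : ∀ n ∈ N, x * n ∈ N := by
    intro n hn
    induction hn using Submodule.span_induction with
    | mem n hn =>
      rcases hn with ⟨s, rfl⟩ | ⟨s, rfl⟩ | ⟨s, rfl⟩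
      · rw [m1, ← mul_assoc, ← pow_succ']; exact h1 _ _
      · rw [m2, ← mul_assoc, ← pow_succ']; exact h2 _ _ _ _
      · rw [m3, ← mul_assoc, ← (H.goodxy _ _).1, mul_assoc (_ * _ * _), ← mul_assoc x, ← pow_succ']
        exact h3 _ _ _ _
    | zero => simp
    | add a b _ _ ha hb => rw [mul_add]; exact N.add_mem ha hb
    | smul c a _ ha => rw [mul_smul_comm]; exact N.smul_mem c ha
  have hyx : ∀ t, y * t ∈ N → (∀ a, z * (x ^ a * t) ∈ N) → ∀ a, y * (x ^ a * t) ∈ N := by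
    intro t ht hz a
    induction a with
    | zero => simpa using ht
    | succ a ih =>
      have : y * (x ^ (a + 1) * t) = x * (y * (x ^ a * t)) - z * (x ^ a * t) := by
        rw [H.hz, pow_succ']; noncomm_ring
      rw [this]
      exact N.sub_mem (hx _ ih) (hz a)
  have hy : ∀ n ∈ N, y * n ∈ N := by
    intro n hn
    induction hn using Submodule.span_induction with
    | mem n hn =>
      rcases hn with ⟨s, rfl⟩ | ⟨s, rfl⟩ | ⟨s, rfl⟩
      · rw [m1]
        apply hyx
        · rw [← pow_succ']; simpa using h1 0 (s 1 + 1)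
        · intro a; simpa using h2 0 0 a (s 1)
      · rw [m2]
        apply hyx
        · rw [← mul_assoc, ← pow_succ']; simpa using h2 0 (s 1 + 1) (s 2) (s 3)
        · intro a; simpa [mul_assoc] using h3 a (s 1) (s 2) (s 3)
      · rw [m3, ← mul_assoc _ (x ^ _) (y ^ _), ← mul_assoc y,
          ← ((H.goodxy _ _).mulr H _).1, mul_assoc, mul_assoc (_ * _ * _), ← pow_succ']
        exact h3 _ _ _ _
    | zero => simp
    | add a b _ _ ha hb => rw [mul_add]; exact N.add_mem ha hb
    | smul c a _ ha => rw [mul_smul_comm]; exact N.smul_mem c ha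
  rw [eq_top_iff]
  rintro a -
  have key : ∀ n ∈ N, a * n ∈ N := by
    have ha : a ∈ Algebra.adjoin K {x, y} := by rw [hadj]; trivial
    induction ha using Algebra.adjoin_induction with
    | mem t ht =>
      rcases ht with rfl | rfl
      · exact hx
      · exact hy
    | algebraMap r => intro n hn; rw [← Algebra.smul_def]; exact N.smul_mem r hn
    | add a b _ _ ha hb => intro n hn; rw [add_mul]; exact N.add_mem (ha n hn) (hb n hn)
    | mul a b _ _ ha hb => intro n hn; rw [mul_assoc]; exact ha _ (hb n hn)
  simpa using key 1 (by simpa using h1 0 0)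

lemma hyp_of {K : Type*} [Field K] [CharZero K] [Algebra K A]
    (hadj : Algebra.adjoin K {x, y} = ⊤) (hz : z = x * y - y * x)
    (g : ∀ p q : A, br (br p q ^ 2) p = 0) (z3 : z ^ 3 = 0) : Hyp x y z where
  hz := hz
  g := g
  z3 := z3
  two := by
    intro a ha
    have h : (2 : K) • a = 0 := by rw [two_smul]; exact ha
    exact (smul_eq_zero_iff_right two_ne_zero).1 h
  gen := by
    intro k hk hkz
    have aux : ∀ t, k * (x * t - t * x) = 0 → k * (y * t - t * y) = 0 →
        ∀ b, k * (b * t - t * b) = 0 := by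
      intro t h1 h2 b
      have hb : b ∈ Algebra.adjoin K {x, y} := by rw [hadj]; trivial
      induction hb using Algebra.adjoin_induction with
      | mem s hs =>
        rcases hs with rfl | rfl
        · exact h1
        · exact h2
      | algebraMap r => rw [Algebra.commutes]; simp
      | add a b _ _ ha hb =>
        have : k * ((a + b) * t - t * (a + b)) = k * (a * t - t * a) + k * (b * t - t * b) := by
          noncomm_ring
        rw [this, ha, hb, add_zero]
      | mul a b _ _ ha hb =>
        have : k * (a * b * t - t * (a * b)) = k * a * (b * t - t * b) + k * (a * t - t * a) * b := by
          noncomm_ring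
        rw [this, ha, hk, mul_assoc, hb]; simp
    intro b
    constructor
    · have := aux x (by simp) (by rw [← neg_sub, ← hz, mul_neg, hkz, neg_zero]) b
      rw [← mul_assoc, ← hk, mul_assoc, mul_assoc, ← sub_eq_zero, ← mul_sub]; exact this
    · have := aux y (by rw [← hz, hkz]) (by simp) b
      rw [← mul_assoc, ← hk, mul_assoc, mul_assoc, ← sub_eq_zero, ← mul_sub]; exact this
  cen := by
    intro k h1 h2 b
    have hb : b ∈ Algebra.adjoin K {x, y} := by rw [hadj]; trivial
    induction hb using Algebra.adjoin_induction with
    | mem s hs =>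
      rcases hs with rfl | rfl
      · exact h1
      · exact h2
    | algebraMap r => exact (Algebra.commutes _ _).symm
    | add a b _ _ ha hb => rw [mul_add, add_mul, ha, hb]
    | mul a b _ _ ha hb => rw [← mul_assoc, ha, mul_assoc, hb, mul_assoc]
end

lemma ad_ne (K : Type*) [Field K] :
    (ExteriorAlgebra.ι K (Finsupp.single 0 1 : ℕ →₀ K) : GrassmannAlg K) *
      ExteriorAlgebra.ι K (Finsupp.single 1 1 : ℕ →₀ K) ≠ 0 := by
  intro h
  let P : Matrix (Fin 4) (Fin 4) K := !![0,0,0,0;1,0,0,0;0,0,0,0;0,0,1,0]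
  let Q : Matrix (Fin 4) (Fin 4) K := !![0,0,0,0;0,0,0,0;1,0,0,0;0,-1,0,0]
  let f : (ℕ →₀ K) →ₗ[K] Matrix (Fin 4) (Fin 4) K :=
    (Finsupp.lapply 0).smulRight P + (Finsupp.lapply 1).smulRight Q
  have hf : ∀ m, f m * f m = 0 := by
    intro m
    have hP : P * P = 0 := by
      ext i j; fin_cases i <;> fin_cases j <;> simp [P, Matrix.mul_apply, Fin.sum_univ_four]
    have hQ : Q * Q = 0 := by
      ext i j; fin_cases i <;> fin_cases j <;> simp [Q, Matrix.mul_apply, Fin.sum_univ_four]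
    have hPQ : P * Q + Q * P = 0 := by
      ext i j; fin_cases i <;> fin_cases j <;> simp [P, Q, Matrix.mul_apply, Fin.sum_univ_four]
    have e : f m = m 0 • P + m 1 • Q := by simp [f]
    have : (m 0 • P + m 1 • Q) * (m 0 • P + m 1 • Q) =
        (m 0 * m 0) • (P * P) + (m 0 * m 1) • (P * Q + Q * P) + (m 1 * m 1) • (Q * Q) := by
      simp only [add_mul, mul_add, smul_mul_smul_comm, smul_add, mul_comm (m 1) (m 0)]
      abel
    rw [e, this, hP, hQ, hPQ]; simp
  have h2 := congrArg (ExteriorAlgebra.lift K ⟨f, hf⟩) h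
  rw [map_mul, ExteriorAlgebra.lift_ι_apply, ExteriorAlgebra.lift_ι_apply, map_zero] at h2
  have h3 := congrFun (congrFun h2 3) 0
  simp [f, P, Q, Matrix.mul_apply, Fin.sum_univ_four] at h3

def XX {K : Type*} [Field K] (s t : K) : Matrix (Fin 3) (Fin 3) K := !![s,0,0;0,t,0;0,1,s]
def YY {K : Type*} [Field K] (s t : K) : Matrix (Fin 3) (Fin 3) K := !![s,0,0;1,t,0;0,0,s]
def phi {K : Type*} [Field K] (a b c d : K) :
    FreeAlgebra K (Fin 2) →ₐ[K] Matrix (Fin 3) (Fin 3) K :=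
  FreeAlgebra.lift K ![XX a b, YY c d]

def JJ {K : Type*} [Field K] {E : Type*} [Ring E] [Algebra K E] (a d : E) :
    (Fin 3 → K) →ₗ[K] (Fin 2 → E) where
  toFun v := ![algebraMap K E (v 0) + v 2 • (a * d), v 1 • d]
  map_add' v w := by
    ext i; fin_cases i <;> simp [add_smul]; abel
  map_smul' c v := by
    ext i; fin_cases i <;> simp [mul_smul, Algebra.smul_def, mul_assoc, mul_add]

lemma phi_zero {K : Type*} [Field K] (f : FreeAlgebra K (Fin 2))
    (hf : f ∈ polyIdentities₂ K (M11 K)) (x1 x2 y1 y2 : K) : phi x1 x2 y1 y2 f = 0 := by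
  set a : GrassmannAlg K := ExteriorAlgebra.ι K (Finsupp.single 0 1 : ℕ →₀ K) with ha
  set d : GrassmannAlg K := ExteriorAlgebra.ι K (Finsupp.single 1 1 : ℕ →₀ K) with hd
  have had : a * d ≠ 0 := ad_ne K
  have haa : a * a = 0 := ExteriorAlgebra.ι_sq_zero _
  have hdd : d * d = 0 := ExteriorAlgebra.ι_sq_zero _
  have hda : a * d + d * a = 0 := ExteriorAlgebra.ι_add_mul_swap _ _
  have hdad : d * (a * d) = 0 := by
    have : d * (a * d) = (a * d + d * a) * d - a * (d * d) := by noncomm_ring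
    rw [this, hda, hdd]; simp
  have ho : ∀ m, (ExteriorAlgebra.ι K m : GrassmannAlg K) ∈ evenOdd (0 : QuadraticForm K (ℕ →₀ K)) 1 :=
    fun m => ι_mem_evenOdd_one _ m
  have hs : ∀ r, algebraMap K (GrassmannAlg K) r ∈ evenOdd (0 : QuadraticForm K (ℕ →₀ K)) 0 :=
    fun r => SetLike.algebraMap_mem_graded (evenOdd (0 : QuadraticForm K (ℕ →₀ K))) r
  let X : M11 K := ⟨!![algebraMap K _ x1, a; 0, algebraMap K _ x2],
    hs _, hs _, ho _, zero_mem _⟩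
  let Y : M11 K := ⟨!![algebraMap K _ y1, 0; d, algebraMap K _ y2],
    hs _, hs _, zero_mem _, ho _⟩
  let ψ : FreeAlgebra K (Fin 2) →ₐ[K] Matrix (Fin 2) (Fin 2) (GrassmannAlg K) :=
    (M11 K).val.comp (FreeAlgebra.lift K ![X, Y])
  have hψ : ψ f = 0 := by
    have := hf (FreeAlgebra.lift K ![X, Y])
    simp [ψ, this]
  have inter : ∀ g (v : Fin 3 → K), (ψ g).mulVec (JJ a d v) = JJ a d ((phi x1 x2 y1 y2 g).mulVec v) := by
    intro g
    induction g using FreeAlgebra.induction with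
    | grade0 r =>
      intro v
      rw [AlgHom.commutes, AlgHom.commutes]
      rw [Algebra.algebraMap_eq_smul_one, Algebra.algebraMap_eq_smul_one, Matrix.smul_mulVec,
        Matrix.smul_mulVec, Matrix.one_mulVec, Matrix.one_mulVec, map_smul]
    | grade1 i =>
      intro v
      fin_cases i
      · simp only [ψ, phi, X, XX]
        ext i; fin_cases i
        · simp [Matrix.mulVec, dotProduct, Fin.sum_univ_two, Fin.sum_univ_three, JJ,
            Algebra.smul_def, mul_add, add_mul, mul_assoc]
          rw [← mul_assoc a, ← Algebra.commutes (v 1) a]; simp [mul_assoc]; abel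
        · simp [Matrix.mulVec, dotProduct, Fin.sum_univ_two, Fin.sum_univ_three, JJ,
            Algebra.smul_def, mul_add, add_mul, mul_assoc]
      · simp only [ψ, phi, Y, YY]
        ext i; fin_cases i
        · simp [Matrix.mulVec, dotProduct, Fin.sum_univ_two, Fin.sum_univ_three, JJ,
            Algebra.smul_def, mul_add, add_mul, mul_assoc]
        · simp [Matrix.mulVec, dotProduct, Fin.sum_univ_two, Fin.sum_univ_three, JJ,
            Algebra.smul_def, mul_add, add_mul, mul_assoc]
          rw [← mul_assoc d, ← Algebra.commutes (v 2) d, ← Algebra.commutes (v 0) d, mul_assoc, hdad]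
          simp
    | mul g h hg hh => intro v; rw [map_mul, map_mul, ← Matrix.mulVec_mulVec, hh, hg, Matrix.mulVec_mulVec]
    | add g h hg hh => intro v; rw [map_add, map_add, Matrix.add_mulVec, hg, hh, Matrix.add_mulVec, map_add]
  have inj : ∀ v : Fin 3 → K, JJ a d v = (0 : Fin 2 → GrassmannAlg K) → v = 0 := by
    intro v hv
    have e0 : algebraMap K (GrassmannAlg K) (v 0) + v 2 • (a * d) = 0 := congrFun hv 0
    have e1 : v 1 • d = 0 := congrFun hv 1
    have hd0 : d ≠ 0 := by rintro h; apply had; rw [h, mul_zero]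
    have v1 : v 1 = 0 := (smul_eq_zero.1 e1).resolve_right hd0
    have v0 : v 0 = 0 := by
      have := congrArg (fun t => t * (a * d)) e0
      simp only [add_mul, zero_mul, smul_mul_assoc, mul_assoc, hdad, mul_zero, smul_zero,
        add_zero, ← Algebra.smul_def] at this
      exact (smul_eq_zero.1 this).resolve_right had
    have v2 : v 2 = 0 := by
      rw [v0, map_zero, zero_add] at e0
      exact (smul_eq_zero.1 e0).resolve_right had
    ext i; fin_cases i <;> assumption
  have : ∀ v, (phi x1 x2 y1 y2 f).mulVec v = 0 := by
    intro v
    apply inj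
    rw [← inter, hψ, Matrix.zero_mulVec]
  ext i j
  have := congrFun (this (Pi.single j 1)) i
  simpa using this

/-- lower triangular -/
def Low {K : Type*} [Field K] (M : Matrix (Fin 3) (Fin 3) K) (a b c : K) : Prop :=
  M 0 1 = 0 ∧ M 0 2 = 0 ∧ M 1 2 = 0 ∧ M 0 0 = a ∧ M 1 1 = b ∧ M 2 2 = c

section
variable {K : Type*} [Field K]

lemma Low.mul {M N : Matrix (Fin 3) (Fin 3) K} {a b c a' b' c' : K} (h : Low M a b c)
    (h' : Low N a' b' c') : Low (M * N) (a * a') (b * b') (c * c') := by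
  obtain ⟨h1, h2, h3, h4, h5, h6⟩ := h
  obtain ⟨g1, g2, g3, g4, g5, g6⟩ := h'
  simp [Low, Matrix.mul_apply, Fin.sum_univ_three, *]

lemma Low.sub {M N : Matrix (Fin 3) (Fin 3) K} {a b c a' b' c' : K} (h : Low M a b c)
    (h' : Low N a' b' c') : Low (M - N) (a - a') (b - b') (c - c') := by
  obtain ⟨h1, h2, h3, h4, h5, h6⟩ := h
  obtain ⟨g1, g2, g3, g4, g5, g6⟩ := h'
  simp [Low, *]

lemma Low.add {M N : Matrix (Fin 3) (Fin 3) K} {a b c a' b' c' : K} (h : Low M a b c)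
    (h' : Low N a' b' c') : Low (M + N) (a + a') (b + b') (c + c') := by
  obtain ⟨h1, h2, h3, h4, h5, h6⟩ := h
  obtain ⟨g1, g2, g3, g4, g5, g6⟩ := h'
  simp [Low, *]

lemma Low.one : Low (1 : Matrix (Fin 3) (Fin 3) K) 1 1 1 := by simp [Low]

lemma Low.pow {M : Matrix (Fin 3) (Fin 3) K} {a b c : K} (h : Low M a b c) (n : ℕ) :
    Low (M ^ n) (a ^ n) (b ^ n) (c ^ n) := by
  induction n with
  | zero => simpa using Low.one
  | succ n ih => simp only [pow_succ]; exact ih.mul h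

lemma Low.br {M N : Matrix (Fin 3) (Fin 3) K} {a b c a' b' c' : K} (h : Low M a b c)
    (h' : Low N a' b' c') : Low (M * N - N * M) 0 0 0 := by
  have := (h.mul h').sub (h'.mul h)
  simpa [mul_comm] using this

lemma Low.adIter {M N : Matrix (Fin 3) (Fin 3) K} {a b c : K} (h : Low M a b c)
    (h' : Low N 0 0 0) (l : ℕ) : Low (adIter M l N) 0 0 0 := by
  induction l with
  | zero => exact h'
  | succ l ih =>
    unfold _root_.adIter at *
    rw [Function.iterate_succ_apply']
    exact ih.br h

lemma Low.three {M N P : Matrix (Fin 3) (Fin 3) K} (h : Low M 0 0 0)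
    (h' : Low N 0 0 0) (h'' : Low P 0 0 0) : M * N * P = 0 := by
  obtain ⟨h1, h2, h3, h4, h5, h6⟩ := h
  obtain ⟨g1, g2, g3, g4, g5, g6⟩ := h'
  obtain ⟨k1, k2, k3, k4, k5, k6⟩ := h''
  ext i j
  fin_cases i <;> fin_cases j <;> simp [Matrix.mul_apply, Fin.sum_univ_three, *]

lemma Low.two {M N P : Matrix (Fin 3) (Fin 3) K} {a b : K} (h : Low M 0 0 0)
    (h' : Low N 0 0 0) (h'' : Low P a b a) : M * N * P - P * (M * N) = 0 := by
  obtain ⟨h1, h2, h3, h4, h5, h6⟩ := h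
  obtain ⟨g1, g2, g3, g4, g5, g6⟩ := h'
  obtain ⟨k1, k2, k3, k4, k5, k6⟩ := h''
  ext i j
  fin_cases i <;> fin_cases j <;> simp [Matrix.mul_apply, Fin.sum_univ_three, *]
  ring

lemma phi_low (x1 x2 y1 y2 : K) (g : FreeAlgebra K (Fin 2)) :
    ∃ a b, Low (phi x1 x2 y1 y2 g) a b a := by
  induction g using FreeAlgebra.induction with
  | grade0 r => exact ⟨r, r, by simp [Low, Matrix.algebraMap_matrix_apply]⟩
  | grade1 i =>
    fin_cases i
    · exact ⟨x1, x2, by simp [Low, phi, XX]⟩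
    · exact ⟨y1, y2, by simp [Low, phi, YY]⟩
  | mul g h hg hh =>
    obtain ⟨a, b, hg⟩ := hg
    obtain ⟨a', b', hh⟩ := hh
    exact ⟨_, _, by rw [map_mul]; exact hg.mul hh⟩
  | add g h hg hh =>
    obtain ⟨a, b, hg⟩ := hg
    obtain ⟨a', b', hh⟩ := hh
    exact ⟨_, _, by rw [map_add]; exact hg.add hh⟩

lemma map_adIter {A B : Type*} [Ring A] [Ring B] (φ : A →+* B) (c z : A) (l : ℕ) :
    φ (adIter c l z) = adIter (φ c) l (φ z) := by
  induction l with
  | zero => rfl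
  | succ l ih =>
    unfold adIter at *
    rw [Function.iterate_succ_apply', Function.iterate_succ_apply', ← ih]
    simp

lemma phi_T (x1 x2 y1 y2 : K) {t : FreeAlgebra K (Fin 2)}
    (ht : t ∈ TIdealGen₂ K ({_root_.br (_root_.br (xvar K) (yvar K) ^ 2) (xvar K)} ∪
          {g | ∃ l : ℕ,
            g = _root_.br (xvar K) (yvar K) ^ 2 * adIter (xvar K) l (_root_.br (xvar K) (yvar K))})) :
    phi x1 x2 y1 y2 t = 0 := by
  rw [← TwoSidedIdeal.mem_ker]
  refine (TwoSidedIdeal.span_le.2 ?_) ht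
  rintro g ⟨f, hf, ψ, rfl⟩
  rw [SetLike.mem_coe, TwoSidedIdeal.mem_ker]
  obtain ⟨a, b, hX⟩ := phi_low x1 x2 y1 y2 (ψ (xvar K))
  obtain ⟨c, d, hY⟩ := phi_low x1 x2 y1 y2 (ψ (yvar K))
  rcases hf with rfl | ⟨l, rfl⟩
  · simp only [br, map_sub, map_mul, pow_two]
    exact (hX.br hY).two (hX.br hY) hX
  · have e : ∀ w, phi x1 x2 y1 y2 (ψ (adIter (xvar K) l w)) =
        adIter (phi x1 x2 y1 y2 (ψ (xvar K))) l (phi x1 x2 y1 y2 (ψ w)) := fun w =>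
      map_adIter (((phi x1 x2 y1 y2).comp ψ).toRingHom) _ _ _
    rw [map_mul, map_mul, e]
    simp only [br, map_sub, map_mul, pow_two]
    exact (hX.br hY).three (hX.br hY) (hX.adIter (hX.br hY) l)
end

section
variable {K : Type*} [Field K]

lemma XX_low (s t : K) : Low (XX s t) s t s := by simp [Low, XX]
lemma YY_low (s t : K) : Low (YY s t) s t s := by simp [Low, YY]

def LL {A : Type*} [Ring A] [Algebra K A] {n : ℕ} (m : (Fin n →₀ ℕ) → A) :
    MvPolynomial (Fin n) K →ₗ[K] A :=
  (MvPolynomial.basisMonomials (Fin n) K).constr K m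

lemma LL_mon {A : Type*} [Ring A] [Algebra K A] {n : ℕ} (m : (Fin n →₀ ℕ) → A) (s : Fin n →₀ ℕ) :
    LL m (MvPolynomial.monomial s (1 : K)) = m s := by
  have := (MvPolynomial.basisMonomials (Fin n) K).constr_basis K m s
  simpa [LL] using this

/-- computing a matrix entry of `LL m p` -/
lemma LL_entry {n : ℕ} (m : (Fin n →₀ ℕ) → Matrix (Fin 3) (Fin 3) K) (i j : Fin 3)
    (v : Fin n → K) (c : K) (h : ∀ s, m s i j = (∏ k, v k ^ s k) * c)
    (p : MvPolynomial (Fin n) K) : LL m p i j = MvPolynomial.eval v p * c := by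
  induction p using MvPolynomial.induction_on' with
  | monomial s a =>
    have e : MvPolynomial.monomial s a = a • MvPolynomial.monomial s (1 : K) := by
      rw [MvPolynomial.smul_monomial]; simp
    rw [e, map_smul, LL_mon, Matrix.smul_apply, h, MvPolynomial.smul_eval,
      MvPolynomial.eval_monomial, Finsupp.prod_fintype _ _ (by simp)]
    simp [mul_assoc]
  | add p q hp hq => rw [map_add, Matrix.add_apply, hp, hq, map_add, add_mul]

lemma LL_map {A B : Type*} [Ring A] [Algebra K A] [Ring B] [Algebra K B] {n : ℕ}
    (f : A →ₐ[K] B) (m : (Fin n →₀ ℕ) → A) (m' : (Fin n →₀ ℕ) → B) (h : ∀ s, f (m s) = m' s)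
    (p : MvPolynomial (Fin n) K) : f (LL m p) = LL m' p := by
  have : f.toLinearMap ∘ₗ LL m = LL m' := by
    apply (MvPolynomial.basisMonomials (Fin n) K).ext
    intro s
    simp [LL_mon, h]
  exact LinearMap.congr_fun this p

lemma zz_low (x1 x2 y1 y2 : K) :
    Low (XX x1 x2 * YY y1 y2 - YY y1 y2 * XX x1 x2) 0 0 0 := (XX_low _ _).br (YY_low _ _)

lemma low3 {M Z N : Matrix (Fin 3) (Fin 3) K} {a b c a' b' c' : K} (h : Low M a b c)
    (h0 : Low Z 0 0 0) (h' : Low N a' b' c') : (M * (Z * N)) 2 1 = c * Z 2 1 * b' := by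
  obtain ⟨h1, h2, h3, h4, h5, h6⟩ := h
  obtain ⟨g1, g2, g3, g4, g5, g6⟩ := h'
  obtain ⟨k1, k2, k3, k4, k5, k6⟩ := h0
  simp [Matrix.mul_apply, Fin.sum_univ_three, *]
  try ring

lemma low4 {M Z N : Matrix (Fin 3) (Fin 3) K} {a b c a' b' c' : K} (h : Low M a b c)
    (h0 : Low Z 0 0 0) (h' : Low N a' b' c') :
    (Z * M * Z * N) 2 0 = Z 2 1 * b * Z 1 0 * a' := by
  obtain ⟨h1, h2, h3, h4, h5, h6⟩ := h
  obtain ⟨g1, g2, g3, g4, g5, g6⟩ := h'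
  obtain ⟨k1, k2, k3, k4, k5, k6⟩ := h0
  simp [Matrix.mul_apply, Fin.sum_univ_three, *]

lemma indep [CharZero K] (p : MvPolynomial (Fin 2) K) (q r : MvPolynomial (Fin 4) K)
    (h : ∀ x1 x2 y1 y2 : K,
      LL (m1 (XX x1 x2) (YY y1 y2)) p +
      LL (m2 (XX x1 x2) (YY y1 y2) (XX x1 x2 * YY y1 y2 - YY y1 y2 * XX x1 x2)) q +
      LL (m3 (XX x1 x2) (YY y1 y2) (XX x1 x2 * YY y1 y2 - YY y1 y2 * XX x1 x2)) r = 0) :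
    p = 0 ∧ q = 0 ∧ r = 0 := by
  have z21 : ∀ x1 x2 y1 y2 : K,
      (XX x1 x2 * YY y1 y2 - YY y1 y2 * XX x1 x2) 2 1 = y2 - y1 := by
    intro x1 x2 y1 y2
    simp [XX, YY, Matrix.mul_apply, Fin.sum_univ_three]
  have z10 : ∀ x1 x2 y1 y2 : K,
      (XX x1 x2 * YY y1 y2 - YY y1 y2 * XX x1 x2) 1 0 = x2 - x1 := by
    intro x1 x2 y1 y2
    simp [XX, YY, Matrix.mul_apply, Fin.sum_univ_three]
  have low1 : ∀ (x1 x2 y1 y2 : K) (a b : ℕ), Low (XX x1 x2 ^ a * YY y1 y2 ^ b)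
      (x1 ^ a * y1 ^ b) (x2 ^ a * y2 ^ b) (x1 ^ a * y1 ^ b) := fun x1 x2 y1 y2 a b =>
    ((XX_low x1 x2).pow a).mul ((YY_low y1 y2).pow b)
  have hp : p = 0 := by
    apply MvPolynomial.funext
    intro v
    have h0 := congrFun (congrFun (h (v 0) 0 (v 1) 0) 0) 0
    rw [Matrix.add_apply, Matrix.add_apply, LL_entry _ 0 0 v 1, LL_entry _ 0 0 (fun _ => 0) 0,
      LL_entry _ 0 0 (fun _ => 0) 0] at h0
    · simpa using h0
    · intro s
      rw [m3]
      have := (((zz_low (v 0) 0 (v 1) 0).mul (low1 (v 0) 0 (v 1) 0 (s 0) (s 1))).mul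
        (zz_low (v 0) 0 (v 1) 0)).mul (low1 (v 0) 0 (v 1) 0 (s 2) (s 3))
      rw [this.2.2.2.1]; simp
    · intro s
      rw [m2, ← mul_assoc]
      have := (low1 (v 0) 0 (v 1) 0 (s 0) (s 1)).mul ((zz_low (v 0) 0 (v 1) 0).mul
        (low1 (v 0) 0 (v 1) 0 (s 2) (s 3)))
      rw [this.2.2.2.1]; simp
    · intro s
      rw [m1, (low1 _ _ _ _ _ _).2.2.2.1]; simp
  subst hp
  have hq : q = 0 := by
    have : q * (MvPolynomial.X 3 - MvPolynomial.X 1) = 0 := by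
      apply MvPolynomial.funext
      intro v
      have h0 := congrFun (congrFun (h (v 0) (v 2) (v 1) (v 3)) 2) 1
      rw [map_zero, zero_add, Matrix.add_apply, LL_entry _ 2 1 v (v 3 - v 1),
        LL_entry _ 2 1 (fun _ => 0) 0] at h0
      · simpa using h0
      · intro s
        have := (((zz_low (v 0) (v 2) (v 1) (v 3)).mul (low1 (v 0) (v 2) (v 1) (v 3) (s 0) (s 1))))
        simp only [mul_zero, zero_mul] at this
        have e := low3 this (zz_low (v 0) (v 2) (v 1) (v 3)) (low1 (v 0) (v 2) (v 1) (v 3) (s 2) (s 3))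
        rw [m3, mul_assoc (_ * _), e]; simp
      · intro s
        rw [m2, ← mul_assoc, low3 (low1 _ _ _ _ _ _) (zz_low _ _ _ _) (low1 _ _ _ _ _ _), z21]
        simp [Fin.prod_univ_four]; ring
    rcases mul_eq_zero.1 this with h | h
    · exact h
    · exfalso
      have := congrArg (MvPolynomial.eval ![0, 0, 0, 1]) h
      simp at this
  subst hq
  refine ⟨rfl, rfl, ?_⟩
  have : r * ((MvPolynomial.X 1 - MvPolynomial.X 3) * (MvPolynomial.X 0 - MvPolynomial.X 2)) = 0 := by
    apply MvPolynomial.funext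
    intro v
    have h0 := congrFun (congrFun (h (v 2) (v 0) (v 3) (v 1)) 2) 0
    rw [map_zero, map_zero, zero_add, zero_add,
      LL_entry _ 2 0 v ((v 1 - v 3) * (v 0 - v 2))] at h0
    · simpa using h0
    · intro s
      rw [m3, low4 (low1 _ _ _ _ _ _) (zz_low _ _ _ _) (low1 _ _ _ _ _ _), z21, z10]
      simp [Fin.prod_univ_four]; ring
  rcases mul_eq_zero.1 this with h | h
  · exact h
  · exfalso
    have := congrArg (MvPolynomial.eval ![0, 0, 1, 1]) h
    simp at this

end

theorem stmt16 (K : Type*) [Field K] [CharZero K] :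
    polyIdentities₂ K (M11 K) ⊆
      (TIdealGen₂ K ({br (br (xvar K) (yvar K) ^ 2) (xvar K)} ∪
          {g | ∃ l : ℕ,
            g = br (xvar K) (yvar K) ^ 2 * adIter (xvar K) l (br (xvar K) (yvar K))}) :
        Set (FreeAlgebra K (Fin 2))) := by
  intro f hf
  set S := ({br (br (xvar K) (yvar K) ^ 2) (xvar K)} ∪
          {g | ∃ l : ℕ,
            g = br (xvar K) (yvar K) ^ 2 * adIter (xvar K) l (br (xvar K) (yvar K))}) with hS
  let T := TIdealGen₂ K S
  let π : FreeAlgebra K (Fin 2) →ₐ[K] T.ringCon.Quotient := T.ringCon.mkₐ K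
  have hπ : ∀ g, π g = 0 ↔ g ∈ T := by
    intro g
    rw [TwoSidedIdeal.mem_iff]
    exact (RingCon.eq T.ringCon)
  have hsurj : Function.Surjective π := RingCon.mk'_surjective _
  have hgenT : ∀ s ∈ S, ∀ ψ : FreeAlgebra K (Fin 2) →ₐ[K] FreeAlgebra K (Fin 2), π (ψ s) = 0 := by
    intro s hs ψ
    rw [hπ]
    exact TwoSidedIdeal.subset_span ⟨s, hs, ψ, rfl⟩
  have hadj : Algebra.adjoin K {π (xvar K), π (yvar K)} = ⊤ := by
    have h0 := FreeAlgebra.adjoin_range_ι K (Fin 2)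
    have h1 : Set.range (FreeAlgebra.ι K : Fin 2 → _) = {xvar K, yvar K} := by
      ext t
      simp only [Set.mem_range, Fin.exists_fin_two, Set.mem_insert_iff, Set.mem_singleton_iff,
        xvar, yvar, eq_comm]
    rw [h1] at h0
    have h2 := congrArg (Subalgebra.map π) h0
    rw [AlgHom.map_adjoin, Set.image_pair, Algebra.map_top] at h2
    rw [h2]
    exact (AlgHom.range_eq_top π).2 hsurj
  have H : Hyp (π (xvar K)) (π (yvar K)) (π (br (xvar K) (yvar K))) := by
    apply hyp_of (K := K) hadj
    · simp [br]
    · intro p q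
      obtain ⟨p, rfl⟩ := hsurj p
      obtain ⟨q, rfl⟩ := hsurj q
      have := hgenT _ (Or.inl rfl) (FreeAlgebra.lift K ![p, q])
      simpa [br, xvar, yvar] using this
    · have := hgenT _ (Or.inr ⟨0, rfl⟩) (AlgHom.id K _)
      rw [pow_succ, ← map_pow, ← map_mul]
      exact this
  have hspan := H.span_top hadj
  set x := xvar K
  set y := yvar K
  set z := br x y with hz
  have hex : ∃ (p : MvPolynomial (Fin 2) K) (q r : MvPolynomial (Fin 4) K),
      π f = LL (m1 (π x) (π y)) p + LL (m2 (π x) (π y) (π z)) q + LL (m3 (π x) (π y) (π z)) r := by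
    have hm : π f ∈ Submodule.span K (Set.range (m1 (π x) (π y)) ∪
      (Set.range (m2 (π x) (π y) (π z)) ∪ Set.range (m3 (π x) (π y) (π z)))) := by
      rw [hspan]; trivial
    generalize π f = n at hm ⊢
    induction hm using Submodule.span_induction with
    | mem n hn =>
      rcases hn with ⟨s, rfl⟩ | ⟨s, rfl⟩ | ⟨s, rfl⟩
      · exact ⟨MvPolynomial.monomial s 1, 0, 0, by simp [LL_mon]⟩
      · exact ⟨0, MvPolynomial.monomial s 1, 0, by simp [LL_mon]⟩
      · exact ⟨0, 0, MvPolynomial.monomial s 1, by simp [LL_mon]⟩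
    | zero => exact ⟨0, 0, 0, by simp⟩
    | add a b _ _ ha hb =>
      obtain ⟨p, q, r, rfl⟩ := ha
      obtain ⟨p', q', r', rfl⟩ := hb
      exact ⟨p + p', q + q', r + r', by simp only [map_add]; abel⟩
    | smul c a _ ha =>
      obtain ⟨p, q, r, rfl⟩ := ha
      exact ⟨c • p, c • q, c • r, by simp only [map_smul, smul_add]⟩
  obtain ⟨p, q, r, hpqr⟩ := hex
  have hL : π (LL (m1 x y) p + LL (m2 x y z) q + LL (m3 x y z) r) = π f := by
    rw [hpqr, map_add, map_add, LL_map π (m1 x y) (m1 (π x) (π y)) (by simp [m1]),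
      LL_map π (m2 x y z) (m2 (π x) (π y) (π z)) (by simp [m2]),
      LL_map π (m3 x y z) (m3 (π x) (π y) (π z)) (by simp [m3])]
  have hmem : (LL (m1 x y) p + LL (m2 x y z) q + LL (m3 x y z) r) - f ∈ T := by
    rw [← hπ, map_sub, hL, sub_self]
  have hind := indep p q r (by
    intro x1 x2 y1 y2
    have h1 := phi_T x1 x2 y1 y2 hmem
    have hX : phi x1 x2 y1 y2 x = XX x1 x2 := by simp [phi, x, xvar]
    have hY : phi x1 x2 y1 y2 y = YY y1 y2 := by simp [phi, y, yvar]
    have hZ : phi x1 x2 y1 y2 z = XX x1 x2 * YY y1 y2 - YY y1 y2 * XX x1 x2 := by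
      rw [hz, br, map_sub, map_mul, map_mul, hX, hY]
    rw [map_sub, phi_zero f hf, sub_zero, map_add, map_add,
      LL_map (phi x1 x2 y1 y2) (m1 x y) (m1 (XX x1 x2) (YY y1 y2)) (by simp [m1, hX, hY]),
      LL_map (phi x1 x2 y1 y2) (m2 x y z) (m2 (XX x1 x2) (YY y1 y2) (XX x1 x2 * YY y1 y2 - YY y1 y2 * XX x1 x2))
        (by intro s; simp only [m2, map_mul, map_pow, hX, hY, hZ]),
      LL_map (phi x1 x2 y1 y2) (m3 x y z) (m3 (XX x1 x2) (YY y1 y2) (XX x1 x2 * YY y1 y2 - YY y1 y2 * XX x1 x2))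
        (by intro s; simp only [m3, map_mul, map_pow, hX, hY, hZ])] at h1
    exact h1)
  obtain ⟨rfl, rfl, rfl⟩ := hind
  have : π f = 0 := by rw [hpqr]; simp
  exact (hπ f).1 this
end
end

section
/- The set of polynomial identities of M11(E) in two variables, i.e. the set of all f in the free unital associative algebra K<x,y> such that phi(f) = 0 for every K-algebra homomorphism phi from K<x,y> to M11(E), is exactly the T-ideal of K<x,y> generated by the two polynomials h = [[x,y]^2, x] and d = [x,y]^3. -/
noncomputable section

open CliffordAlgebra

set_option linter.unusedSectionVars false
set_option linter.unusedSimpArgs false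
set_option linter.unusedTactic false
set_option linter.unreachableTactic false
section Abs
variable {K : Type*} [Field K] [CharZero K] {A : Type*} [Ring A] [Algebra K A]

lemma aux_comm_two (K : Type*) [Field K] [CharZero K] {A : Type*} [Ring A] [Algebra K A] (z : A) (h : z + z = 0) : z = 0 := by
  have : (2:K) • z = 0 := by rw [two_smul, h]
  rcases smul_eq_zero.mp this with h | h
  · exact absurd h two_ne_zero
  · exact h

/-- abstract hypotheses -/
structure Hyp_s17 (K : Type*) [Field K] {A : Type*} [Ring A] [Algebra K A] (x y w : A) : Prop where
  gen : ∀ S : Submodule K A, 1 ∈ S → (∀ p ∈ S, p * x ∈ S) → (∀ p ∈ S, p * y ∈ S) → ∀ p, p ∈ S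
  hw : w = x * y - y * x
  hh : ∀ a b : A, (a * b - b * a)^2 * a = a * (a * b - b * a)^2
  hd : w ^ 3 = 0

namespace Hyp_s17
variable {x y w : A} (H : Hyp_s17 K x y w)
include H

lemma central (z : A) (h1 : z * x = x * z) (h2 : z * y = y * z) (p : A) : z * p = p * z := by
  refine H.gen (LinearMap.eqLocus (LinearMap.mulLeft K z) (LinearMap.mulRight K z)) ?_ ?_ ?_ p
  · simp
  · intro p hp
    simp only [LinearMap.mem_eqLocus, LinearMap.mulLeft_apply, LinearMap.mulRight_apply] at *
    rw [← mul_assoc, hp, mul_assoc, h1, mul_assoc]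
  · intro p hp
    simp only [LinearMap.mem_eqLocus, LinearMap.mulLeft_apply, LinearMap.mulRight_apply] at *
    rw [← mul_assoc, hp, mul_assoc, h2, mul_assoc]

lemma hh' (a b : A) : (a * b - b * a)^2 * b = b * (a * b - b * a)^2 := by
  have := H.hh b a
  have e : (b * a - a * b)^2 = (a * b - b * a)^2 := by noncomm_ring
  rwa [e] at this

lemma w2 (p : A) : w^2 * p = p * w^2 := by
  apply H.central
  · rw [H.hw]; exact H.hh x y
  · rw [H.hw]; exact H.hh' x y

lemma lin1 (a b c : A) : ((a*b-b*a)*(c*b-b*c) + (c*b-b*c)*(a*b-b*a)) * a + (a*b-b*a)^2 * c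
   = a * ((a*b-b*a)*(c*b-b*c) + (c*b-b*c)*(a*b-b*a)) + c * (a*b-b*a)^2 := by
  rw [← sub_eq_zero]
  apply aux_comm_two K
  have h1 := sub_eq_zero.mpr (H.hh (a + c) b)
  have h2 := sub_eq_zero.mpr (H.hh (a - c) b)
  have h3 := sub_eq_zero.mpr (H.hh c b)
  set u := a*b-b*a with hu
  set v := c*b-b*c with hv
  have e1 : (a + c) * b - b * (a + c) = u + v := by rw [hu, hv]; noncomm_ring
  have e2 : (a - c) * b - b * (a - c) = u - v := by rw [hu, hv]; noncomm_ring
  rw [e1] at h1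
  rw [e2] at h2
  have : ∀ X Y Z W : A, X = 0 → Y = 0 → Z = 0 → W = X - Y - Z - Z → W = 0 := by
    rintro X Y Z W rfl rfl rfl h; simpa using h
  refine this _ _ _ _ h1 h2 h3 ?_
  noncomm_ring

lemma lin2 (a b c : A) : ((a*b-b*a)*(c*b-b*c) + (c*b-b*c)*(a*b-b*a)) * b
   = b * ((a*b-b*a)*(c*b-b*c) + (c*b-b*c)*(a*b-b*a)) := by
  rw [← sub_eq_zero]
  have h1 := sub_eq_zero.mpr (H.hh' (a + c) b)
  have h2 := sub_eq_zero.mpr (H.hh' a b)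
  have h3 := sub_eq_zero.mpr (H.hh' c b)
  set u := a*b-b*a with hu
  set v := c*b-b*c with hv
  have e1 : (a + c) * b - b * (a + c) = u + v := by rw [hu, hv]; noncomm_ring
  rw [e1] at h1
  have : ∀ X Y Z W : A, X = 0 → Y = 0 → Z = 0 → W = X - Y - Z → W = 0 := by
    rintro X Y Z W rfl rfl rfl h; simpa using h
  refine this _ _ _ _ h1 h2 h3 ?_
  noncomm_ring

lemma Qc (c p : A) : (w * (c*y-y*c) + (c*y-y*c)*w) * p = p * (w * (c*y-y*c) + (c*y-y*c)*w) := by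
  apply H.central
  · have := H.lin1 x y c
    rw [← H.hw, H.w2] at this
    exact add_right_cancel this
  · have := H.lin2 x y c
    rwa [← H.hw] at this

end Hyp_s17

/-- the ideal of good elements -/
def Good (w : A) : Submodule K A where
  carrier := {z | (∀ p, z * p = p * z) ∧ z * w = 0}
  add_mem' := by
    rintro a b ⟨h1, h2⟩ ⟨h3, h4⟩
    exact ⟨fun p => by rw [add_mul, mul_add, h1, h3], by rw [add_mul, h2, h4, add_zero]⟩
  zero_mem' := by simp
  smul_mem' := by
    rintro c a ⟨h1, h2⟩
    exact ⟨fun p => by rw [smul_mul_assoc, mul_smul_comm, h1], by rw [smul_mul_assoc, h2, smul_zero]⟩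

namespace Hyp_s17
variable {x y w : A} (H : Hyp_s17 K x y w)
include H

lemma good_mul {z : A} (hz : z ∈ Good (K := K) w) (p : A) : z * p ∈ Good (K := K) w := by
  obtain ⟨h1, h2⟩ := hz
  refine ⟨?_, by rw [h1, mul_assoc, h2, mul_zero]⟩
  suffices h : (z * p) * x = x * (z * p) ∧ (z * p) * y = y * (z * p) from H.central _ h.1 h.2
  have hzw (q : A) : z * q * w = 0 := by rw [h1, mul_assoc, h2, mul_zero]
  have hxy (q : A) : z * q * x * y = z * q * y * x := by
    have := hzw q
    rw [H.hw, mul_sub, sub_eq_zero] at this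
    simpa only [mul_assoc] using this
  refine H.gen (LinearMap.eqLocus (LinearMap.mulRight K x ∘ₗ LinearMap.mulLeft K z) (LinearMap.mulLeft K x ∘ₗ LinearMap.mulLeft K z) ⊓ LinearMap.eqLocus (LinearMap.mulRight K y ∘ₗ LinearMap.mulLeft K z) (LinearMap.mulLeft K y ∘ₗ LinearMap.mulLeft K z)) ?_ ?_ ?_ p
  · simp [h1]
  · rintro p ⟨ha, hb⟩
    simp only [Submodule.mem_inf, LinearMap.mem_eqLocus, LinearMap.comp_apply, LinearMap.mulLeft_apply, LinearMap.mulRight_apply, SetLike.mem_coe] at *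
    constructor
    · rw [← mul_assoc z, ha, mul_assoc x, ha]
    · rw [← mul_assoc z, hxy, hb, mul_assoc]
  · rintro p ⟨ha, hb⟩
    simp only [Submodule.mem_inf, LinearMap.mem_eqLocus, LinearMap.comp_apply, LinearMap.mulLeft_apply, LinearMap.mulRight_apply, SetLike.mem_coe] at *
    constructor
    · rw [← mul_assoc z, ← hxy, ha, mul_assoc]
    · rw [← mul_assoc z, hb, mul_assoc y, hb]

lemma good_mul' {z : A} (hz : z ∈ Good (K := K) w) (p : A) : p * z ∈ Good (K := K) w := by
  rw [← hz.1]; exact H.good_mul hz p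

lemma good_of (p : A) (h : ∀ q, (w * p * w) * q = q * (w * p * w)) : w * p * w ∈ Good (K := K) w := by
  refine ⟨h, ?_⟩
  rw [mul_assoc, ← pow_two, ← H.w2, ← mul_assoc, ← pow_succ, H.hd, zero_mul]

/-- an element in Good + central -/
lemma good_of_add {p g : A} (hg : g ∈ Good (K := K) w)
    (h : ∀ q, (w * p * w + g) * q = q * (w * p * w + g)) : w * p * w ∈ Good (K := K) w := by
  refine H.good_of p fun q => ?_
  have := h q
  rw [add_mul, mul_add, hg.1] at this
  exact add_right_cancel this

omit [CharZero K] in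
lemma pow_comm (n : ℕ) : x ^ n * y - y * x ^ n = ∑ a ∈ Finset.range n, x ^ a * w * x ^ (n - 1 - a) := by
  induction n with
  | zero => simp
  | succ n ih =>
    rw [Finset.sum_range_succ]
    have : ∑ a ∈ Finset.range n, x ^ a * w * x ^ (n + 1 - 1 - a) = (x ^ n * y - y * x ^ n) * x := by
      rw [ih, Finset.sum_mul]
      refine Finset.sum_congr rfl fun a ha => ?_
      rw [mul_assoc (_ * _), ← pow_succ]
      congr 2
      have := Finset.mem_range.mp ha
      omega
    rw [this, H.hw]
    simp only [Nat.add_sub_cancel, Nat.sub_self, pow_zero, mul_one, pow_succ]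
    noncomm_ring

omit [CharZero K] in
lemma pow_comm' (n : ℕ) : y ^ n * x = x * y ^ n - ∑ a ∈ Finset.range n, y ^ a * w * y ^ (n - 1 - a) := by
  induction n with
  | zero => simp
  | succ n ih =>
    rw [Finset.sum_range_succ]
    have : ∑ a ∈ Finset.range n, y ^ a * w * y ^ (n + 1 - 1 - a) = (x * y ^ n - y ^ n * x) * y := by
      rw [ih, sub_sub_cancel, Finset.sum_mul]
      refine Finset.sum_congr rfl fun a ha => ?_
      rw [mul_assoc (_ * _), ← pow_succ]
      congr 2
      have := Finset.mem_range.mp ha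
      omega
    rw [this, H.hw]
    simp only [Nat.add_sub_cancel, Nat.sub_self, pow_zero, mul_one, pow_succ]
    noncomm_ring

lemma good_w2 : w * w ∈ Good (K := K) w := by
  have := H.good_of 1 (by simpa [← pow_two] using H.w2)
  simpa using this

lemma good_ord (b : ℕ) : ∀ j, w * (x ^ b * y ^ j) * w ∈ Good (K := K) w := by
  induction b using Nat.strong_induction_on with
  | _ b ih =>
  -- expansion of Q(x^{b+1} y^j)
  have key (j : ℕ) : w * (x ^ (b+1) * y^j * y - y * (x ^ (b+1) * y^j)) + (x ^ (b+1) * y^j * y - y * (x ^ (b+1) * y^j)) * w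
      = w * (x ^ b * y ^ j) * w + (w * x ^ b * w * y ^ j +
        ((∑ a ∈ Finset.range b, w * x ^ a * w * (x ^ (b - a) * y ^ j)) +
         (∑ a ∈ Finset.range b, x ^ (a+1) * (w * (x ^ (b - (a + 1)) * y ^ j) * w)))) := by
    have e : x ^ (b+1) * y^j * y - y * (x ^ (b+1) * y^j) = ∑ a ∈ Finset.range (b+1), x ^ a * w * x ^ (b - a) * y ^ j := by
      have := H.pow_comm (b+1)
      simp only [Nat.add_sub_cancel] at this
      rw [← Finset.sum_mul, ← this, sub_mul, mul_assoc (x ^ (b+1)) (y ^ j) y, mul_assoc (x ^ (b+1)) y,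
        ← pow_succ, ← pow_succ', mul_assoc]
    rw [e, Finset.mul_sum, Finset.sum_mul, Finset.sum_range_succ, Finset.sum_range_succ' (n := b)]
    simp only [Nat.sub_self, Nat.sub_zero, pow_zero, one_mul, mul_one, mul_assoc]
    abel
  have rest (j : ℕ) : ((∑ a ∈ Finset.range b, w * x ^ a * w * (x ^ (b - a) * y ^ j)) +
         (∑ a ∈ Finset.range b, x ^ (a+1) * (w * (x ^ (b - (a + 1)) * y ^ j) * w))) ∈ Good (K := K) w := by
    refine add_mem (sum_mem fun a ha => ?_) (sum_mem fun a ha => ?_)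
    · have := ih a (Finset.mem_range.mp ha) 0
      rw [pow_zero, mul_one] at this
      exact H.good_mul this _
    · have := Finset.mem_range.mp ha
      exact H.good_mul' (ih _ (by omega) j) _
  have h0 : w * x ^ b * w ∈ Good (K := K) w := by
    refine H.good_of _ fun q => ?_
    rw [← sub_eq_zero]
    apply aux_comm_two K
    have := H.Qc (x ^ (b+1) * y^0) q
    rw [key] at this
    have r := (rest 0).1 q
    generalize ((∑ a ∈ Finset.range b, w * x ^ a * w * (x ^ (b - a) * y ^ 0)) +
         (∑ a ∈ Finset.range b, x ^ (a+1) * (w * (x ^ (b - (a + 1)) * y ^ 0) * w))) = R at *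
    simp only [pow_zero, mul_one] at this
    rw [← sub_eq_zero] at this r
    have e : ∀ X Y Z : A, X = 0 → Y = 0 → Z = X - Y → Z = 0 := by
      rintro X Y Z rfl rfl h; simpa using h
    refine e _ _ _ this r ?_
    simp only [add_mul, mul_add]
    abel
  intro j
  refine H.good_of_add (add_mem (H.good_mul h0 (y ^ j)) (rest j)) (fun q => ?_)
  · have := H.Qc (x ^ (b+1) * y^j) q
    rw [key] at this
    exact this


omit [CharZero K] in
lemma decomp (S : Submodule K A) (h1 : ∀ i j : ℕ, x ^ i * y ^ j ∈ S)
    (h2 : ∀ (i j : ℕ) (p : A), x ^ i * y ^ j * w * p ∈ S) (p : A) : p ∈ S := by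
  let U : Submodule K A := Submodule.span K ({q | ∃ i j : ℕ, q = x ^ i * y ^ j} ∪
    {q | ∃ (i j : ℕ) (p : A), q = x ^ i * y ^ j * w * p})
  have u1 (i j : ℕ) : x ^ i * y ^ j ∈ U := Submodule.subset_span (Or.inl ⟨i, j, rfl⟩)
  have u2 (i j : ℕ) (p : A) : x ^ i * y ^ j * w * p ∈ U :=
    Submodule.subset_span (Or.inr ⟨i, j, p, rfl⟩)
  have hU : U ≤ S := by
    refine Submodule.span_le.mpr ?_
    rintro q (⟨i, j, rfl⟩ | ⟨i, j, p, rfl⟩)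
    · exact h1 i j
    · exact h2 i j p
  have step (t : A) (ht : ∀ i j : ℕ, x ^ i * y ^ j * t ∈ U) (q : A) (hq : q ∈ U) : q * t ∈ U := by
    have : U ≤ U.comap (LinearMap.mulRight K t) := by
      refine Submodule.span_le.mpr ?_
      rintro q (⟨i, j, rfl⟩ | ⟨i, j, p, rfl⟩)
      · exact ht i j
      · have := u2 i j (p * t)
        rw [← mul_assoc] at this
        exact this
    exact this hq
  apply hU
  refine H.gen U ?_ (step x ?_) (step y ?_) p
  · simpa using u1 0 0
  · intro i j
    rw [mul_assoc, H.pow_comm', mul_sub, ← mul_assoc, ← pow_succ, Finset.mul_sum]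
    refine sub_mem (u1 _ _) (sum_mem fun a _ => ?_)
    have := u2 i a (y ^ (j - 1 - a))
    simpa only [mul_assoc] using this
  · intro i j
    rw [mul_assoc, ← pow_succ]
    exact u1 _ _

lemma spanning (N : Submodule K A) (h1 : ∀ i j : ℕ, x ^ i * y ^ j ∈ N)
    (h2 : ∀ i j k l : ℕ, x ^ i * y ^ j * w * (x ^ k * y ^ l) ∈ N)
    (h3 : ∀ i j k l : ℕ, x ^ i * y ^ j * w * (x ^ k * y ^ l) * w ∈ N) (p : A) : p ∈ N := by
  refine H.decomp N h1 (fun i j p => ?_) p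
  refine H.decomp (N.comap (LinearMap.mulLeft K (x ^ i * y ^ j * w))) (h2 i j) (fun k l p => ?_) p
  rw [Submodule.mem_comap, LinearMap.mulLeft_apply]
  have hz := H.good_ord k l
  have e : x ^ i * y ^ j * w * (x ^ k * y ^ l * w * p) = x ^ i * y ^ j * (w * (x ^ k * y ^ l) * w) * p := by
    simp only [mul_assoc]
  rw [e]
  have h3' (i j) := h3 i j k l
  have e' (i j) : x ^ i * y ^ j * w * (x ^ k * y ^ l) * w = (w * (x ^ k * y ^ l) * w) * (x ^ i * y ^ j) := by
    rw [hz.1]; simp only [mul_assoc]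
  simp only [e'] at h3'
  generalize w * (x ^ k * y ^ l) * w = z at *
  refine H.decomp (N.comap (LinearMap.mulLeft K (x ^ i * y ^ j * z))) (fun m n => ?_) (fun m n p => ?_) p
  · rw [Submodule.mem_comap, LinearMap.mulLeft_apply]
    have := h3' (i + m) (j + n)
    convert this using 1
    have hc := (H.good_mul hz (y ^ j)).1 (x ^ m)
    have hc' := hz.1 (x ^ i)
    calc x ^ i * y ^ j * z * (x ^ m * y ^ n) = x ^ i * ((z * y ^ j) * x ^ m) * y ^ n := by
          rw [hz.1 (y ^ j)]; simp only [mul_assoc]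
      _ = (x ^ i * z) * x ^ m * (y ^ j * y ^ n) := by
          rw [hc, ← mul_assoc (x ^ m) z, ← hz.1 (x ^ m)]
          have : x ^ i * (z * x ^ m * y ^ j) = x ^ i * z * x ^ m * y ^ j := by simp only [mul_assoc]
          rw [this, mul_assoc _ (y ^ j)]
      _ = _ := by
        rw [hz.1 (x ^ i) |>.symm, pow_add, pow_add]; simp only [mul_assoc]
  · rw [Submodule.mem_comap, LinearMap.mulLeft_apply]
    have : x ^ i * y ^ j * z * (x ^ m * y ^ n * w * p) = x ^ i * y ^ j * ((z * (x ^ m * y ^ n)) * w) * p := by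
      simp only [mul_assoc]
    rw [this, (H.good_mul hz _).2]
    simp

end Hyp_s17

open MvPolynomial in
/-- ordered polynomials -/
noncomputable def L1 (x y : A) : MvPolynomial (Fin 2) K →ₗ[K] A :=
  (basisMonomials (Fin 2) K).constr K (fun s => x ^ s 0 * y ^ s 1)

open MvPolynomial in
/-- polynomials around the commutator -/
noncomputable def L2 (x y : A) : MvPolynomial (Fin 4) K →ₗ[K] A :=
  (basisMonomials (Fin 4) K).constr K
    (fun s => x ^ s 0 * y ^ s 1 * (x * y - y * x) * (x ^ s 2 * y ^ s 3))

omit [CharZero K] in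
lemma L1_mon (x y : A) (s : Fin 2 →₀ ℕ) : L1 (K := K) x y (MvPolynomial.monomial s 1) = x ^ s 0 * y ^ s 1 := by
  have := (MvPolynomial.basisMonomials (Fin 2) K).constr_basis K (fun s => x ^ s 0 * y ^ s 1) s
  simpa [L1] using this

omit [CharZero K] in
lemma L2_mon (x y : A) (s : Fin 4 →₀ ℕ) : L2 (K := K) x y (MvPolynomial.monomial s 1) =
    x ^ s 0 * y ^ s 1 * (x * y - y * x) * (x ^ s 2 * y ^ s 3) := by
  have := (MvPolynomial.basisMonomials (Fin 4) K).constr_basis K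
    (fun s => x ^ s 0 * y ^ s 1 * (x * y - y * x) * (x ^ s 2 * y ^ s 3)) s
  simpa [L2] using this

omit [CharZero K] in
lemma lin_ext {σ M : Type*} [AddCommGroup M] [Module K M] (f g : MvPolynomial σ K →ₗ[K] M)
    (h : ∀ s, f (MvPolynomial.monomial s 1) = g (MvPolynomial.monomial s 1)) (P : MvPolynomial σ K) : f P = g P := by
  have : f = g := (MvPolynomial.basisMonomials σ K).ext (by simpa using h)
  rw [this]

omit [CharZero K] in
lemma L1_map {B : Type*} [Ring B] [Algebra K B] (φ : A →ₐ[K] B) (x y : A) (P) :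
    φ (L1 (K := K) x y P) = L1 (φ x) (φ y) P :=
  lin_ext (φ.toLinearMap ∘ₗ L1 x y) (L1 (φ x) (φ y)) (fun s => by simp [L1_mon]) P

omit [CharZero K] in
lemma L2_map {B : Type*} [Ring B] [Algebra K B] (φ : A →ₐ[K] B) (x y : A) (P) :
    φ (L2 (K := K) x y P) = L2 (φ x) (φ y) P :=
  lin_ext (φ.toLinearMap ∘ₗ L2 x y) (L2 (φ x) (φ y)) (fun s => by simp [L2_mon]) P

lemma Hyp_s17.normal {x y w : A} (H : Hyp_s17 K x y w) (p : A) :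
    ∃ P1 P2 P3, p = L1 (K := K) x y P1 + L2 (K := K) x y P2 + L2 (K := K) x y P3 * w := by
  suffices h : p ∈ (L1 (K := K) x y).range ⊔ (L2 (K := K) x y).range ⊔
      (LinearMap.mulRight K w ∘ₗ L2 (K := K) x y).range by
    obtain ⟨_, h1, _, ⟨P3, rfl⟩, rfl⟩ := Submodule.mem_sup.mp h
    obtain ⟨_, ⟨P1, rfl⟩, _, ⟨P2, rfl⟩, rfl⟩ := Submodule.mem_sup.mp h1
    exact ⟨P1, P2, P3, rfl⟩
  refine H.spanning _ (fun i j => ?_) (fun i j k l => ?_) (fun i j k l => ?_) p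
  · refine Submodule.mem_sup_left (Submodule.mem_sup_left
      ⟨MvPolynomial.monomial (Finsupp.equivFunOnFinite.symm ![i, j]) 1, ?_⟩)
    rw [L1_mon]; simp
  · refine Submodule.mem_sup_left (Submodule.mem_sup_right
      ⟨MvPolynomial.monomial (Finsupp.equivFunOnFinite.symm ![i, j, k, l]) 1, ?_⟩)
    rw [L2_mon, H.hw]; simp
  · refine Submodule.mem_sup_right
      ⟨MvPolynomial.monomial (Finsupp.equivFunOnFinite.symm ![i, j, k, l]) 1, ?_⟩
    rw [LinearMap.comp_apply, LinearMap.mulRight_apply, L2_mon, H.hw]; simp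

/-- shape of matrices occurring in the model -/
def Form (g h : A) (M : Matrix (Fin 2) (Fin 2) A) (m0 m1 : K) : Prop :=
  ∃ p q q' r : K, M = !![m0 • 1 + p • (g * h), q • g; q' • h, m1 • 1 + r • (g * h)]

omit [CharZero K] in
lemma Form.mul {g h : A} (hg : g * g = 0) (hh : h * h = 0) (hgh : h * g = - (g * h))
    {M M' : Matrix (Fin 2) (Fin 2) A} {m0 m1 m0' m1' : K}
    (H : Form g h M m0 m1) (H' : Form g h M' m0' m1') : Form g h (M * M') (m0 * m0') (m1 * m1') := by
  obtain ⟨p, q, q', r, rfl⟩ := H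
  obtain ⟨s, t, t', u, rfl⟩ := H'
  have e1 : g * (g * h) = 0 := by rw [← mul_assoc, hg, zero_mul]
  have e2 : h * (g * h) = 0 := by rw [← mul_assoc, hgh, neg_mul, mul_assoc, hh, mul_zero, neg_zero]
  refine ⟨m0 * s + p * m0' + q * t', m0 * t + q * m1', q' * m0' + m1 * t', m1 * u + r * m1' - q' * t, ?_⟩
  ext i j
  fin_cases i <;> fin_cases j <;>
    simp [Matrix.mul_apply, Fin.sum_univ_two, mul_add, add_mul, mul_assoc, e1, e2, hg, hh, hgh, smul_smul, add_smul, sub_smul, mul_comm] <;> abel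

omit [CharZero K] in
lemma Form.pow {g h : A} (hg : g * g = 0) (hh : h * h = 0) (hgh : h * g = - (g * h))
    {M : Matrix (Fin 2) (Fin 2) A} {m0 m1 : K}
    (H : Form g h M m0 m1) (n : ℕ) : Form g h (M ^ n) (m0 ^ n) (m1 ^ n) := by
  induction n with
  | zero =>
    refine ⟨0, 0, 0, 0, ?_⟩
    ext i j
    fin_cases i <;> fin_cases j <;> simp
  | succ n ih => simp only [pow_succ]; exact ih.mul hg hh hgh H

section model
variable {g h : A} (a b c d : K)

omit [CharZero K] in
lemma model_w : (!![a • 1, 0; 0, b • 1] * !![c • 1, g; h, d • 1] - !![c • 1, g; h, d • 1] * !![a • 1, 0; 0, b • 1] : Matrix (Fin 2) (Fin 2) A)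
  = !![0, (a - b) • g; -((a - b) • h), 0] := by
  ext i j
  fin_cases i <;> fin_cases j <;>
    simp [Matrix.mul_apply, Fin.sum_univ_two, smul_smul, sub_smul, mul_comm]

omit [CharZero K] in
lemma model_L2 (hg : g * g = 0) (hh : h * h = 0) (hgh : h * g = - (g * h)) (P) :
    (L2 (K := K) (!![a • 1, 0; 0, b • 1] : Matrix (Fin 2) (Fin 2) A) !![c • 1, g; h, d • 1] P) 0 1
      = ((a - b) * MvPolynomial.eval ![a, c, b, d] P) • g ∧
    (L2 (K := K) (!![a • 1, 0; 0, b • 1] : Matrix (Fin 2) (Fin 2) A) !![c • 1, g; h, d • 1] P) 0 0 * g = 0 := by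
  set X : Matrix (Fin 2) (Fin 2) A := !![a • 1, 0; 0, b • 1] with hX
  set Y : Matrix (Fin 2) (Fin 2) A := !![c • 1, g; h, d • 1] with hY
  have e1 : g * (g * h) = 0 := by rw [← mul_assoc, hg, zero_mul]
  have e2 : h * (g * h) = 0 := by rw [← mul_assoc, hgh, neg_mul, mul_assoc, hh, mul_zero, neg_zero]
  have e3 : g * (h * g) = 0 := by rw [hgh, mul_neg, e1, neg_zero]
  have fX : Form g h X a b := ⟨0, 0, 0, 0, by simp [hX]⟩
  have fY : Form g h Y c d := ⟨0, 1, 1, 0, by simp [hY]⟩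
  have fXY (i j : ℕ) : Form g h (X ^ i * Y ^ j) (a ^ i * c ^ j) (b ^ i * d ^ j) :=
    (fX.pow hg hh hgh i).mul hg hh hgh (fY.pow hg hh hgh j)
  constructor
  · refine lin_ext (Matrix.entryLinearMap K A 0 1 ∘ₗ L2 X Y)
      (LinearMap.toSpanSingleton K A g ∘ₗ ((a - b) • (MvPolynomial.aeval (R := K) ![a, c, b, d]).toLinearMap)) (fun s => ?_) P
    simp only [LinearMap.comp_apply, Matrix.entryLinearMap_apply, L2_mon]
    obtain ⟨p, q, q', r, h1⟩ := fXY (s 0) (s 1)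
    obtain ⟨p', q1, q1', r', h2⟩ := fXY (s 2) (s 3)
    rw [h1, h2, hX, hY, model_w]
    simp [Matrix.mul_apply, Fin.sum_univ_two, mul_add, add_mul, mul_assoc, e1, e2, e3, hg, hh, smul_smul, MvPolynomial.aeval_monomial, Finsupp.prod_fintype, Fin.prod_univ_four]
    congr 1; ring
  · refine lin_ext (LinearMap.mulRight K g ∘ₗ Matrix.entryLinearMap K A 0 0 ∘ₗ L2 X Y) 0 (fun s => ?_) P
    simp only [LinearMap.comp_apply, Matrix.entryLinearMap_apply, L2_mon]
    obtain ⟨p, q, q', r, h1⟩ := fXY (s 0) (s 1)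
    obtain ⟨p', q1, q1', r', h2⟩ := fXY (s 2) (s 3)
    rw [h1, h2, hX, hY, model_w]
    simp [Matrix.mul_apply, Fin.sum_univ_two, mul_add, add_mul, mul_assoc, e1, e2, e3, hg, hh, hgh, smul_smul]

omit [CharZero K] in
lemma scalar_L (P1 P2) : L1 (K := K) (algebraMap K A a) (algebraMap K A c) P1 = algebraMap K A (MvPolynomial.eval ![a, c] P1)
   ∧ L2 (K := K) (algebraMap K A a) (algebraMap K A c) P2 = 0 := by
  constructor
  · refine lin_ext (L1 (K := K) (algebraMap K A a) (algebraMap K A c)) (Algebra.linearMap K A ∘ₗ (MvPolynomial.aeval (R := K) ![a, c]).toLinearMap) (fun s => ?_) P1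
    simp [L1_mon, MvPolynomial.eval_monomial, Finsupp.prod_fintype]
  · refine lin_ext (L2 (K := K) (algebraMap K A a) (algebraMap K A c)) 0 (fun s => ?_) P2
    rw [L2_mon, ← map_mul, ← map_mul, mul_comm c a]; simp
end model
end Abs
section G
variable {K : Type*} [Field K]

lemma even_comm_ι (z : GrassmannAlg K) (hz : z ∈ evenOdd (0 : QuadraticForm K (ℕ →₀ K)) 0) (m : ℕ →₀ K) :
    CliffordAlgebra.ι (0 : QuadraticForm K (ℕ →₀ K)) m * z = z * CliffordAlgebra.ι (0 : QuadraticForm K (ℕ →₀ K)) m := by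
  have sw (a b : ℕ →₀ K) : CliffordAlgebra.ι (0 : QuadraticForm K (ℕ →₀ K)) a * CliffordAlgebra.ι (0 : QuadraticForm K (ℕ →₀ K)) b
     = - (CliffordAlgebra.ι (0 : QuadraticForm K (ℕ →₀ K)) b * CliffordAlgebra.ι (0 : QuadraticForm K (ℕ →₀ K)) a) := by
    rw [eq_neg_iff_add_eq_zero]; exact ExteriorAlgebra.ι_add_mul_swap a b
  refine CliffordAlgebra.even_induction (0 : QuadraticForm K (ℕ →₀ K)) (motive := fun z _ => CliffordAlgebra.ι (0 : QuadraticForm K (ℕ →₀ K)) m * z = z * CliffordAlgebra.ι (0 : QuadraticForm K (ℕ →₀ K)) m) ?_ ?_ ?_ z hz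
  · intro r; exact (Algebra.commutes r _).symm
  · intro x y _ _ h1 h2; rw [mul_add, add_mul, h1, h2]
  · intro a b x _ h
    rw [mul_assoc _ _ (CliffordAlgebra.ι _ m), ← h, ← mul_assoc, ← mul_assoc, ← mul_assoc, sw m a]
    rw [neg_mul, mul_assoc _ (CliffordAlgebra.ι _ m), sw m b, mul_neg, neg_neg, ← mul_assoc]

lemma even_comm (z : GrassmannAlg K) (hz : z ∈ evenOdd (0 : QuadraticForm K (ℕ →₀ K)) 0) (t : GrassmannAlg K) :
    t * z = z * t := by
  induction t using ExteriorAlgebra.induction with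
  | algebraMap r => exact Algebra.commutes r z
  | ι m => exact even_comm_ι z hz m
  | mul a b ha hb => rw [mul_assoc, hb, ← mul_assoc, ha, mul_assoc]
  | add a b ha hb => rw [add_mul, mul_add, ha, hb]

lemma odd_anti_ι (z : GrassmannAlg K) (hz : z ∈ evenOdd (0 : QuadraticForm K (ℕ →₀ K)) 1) (m : ℕ →₀ K) :
    CliffordAlgebra.ι (0 : QuadraticForm K (ℕ →₀ K)) m * z = - (z * CliffordAlgebra.ι (0 : QuadraticForm K (ℕ →₀ K)) m) := by
  refine CliffordAlgebra.odd_induction (0 : QuadraticForm K (ℕ →₀ K)) (P := fun z _ => CliffordAlgebra.ι (0 : QuadraticForm K (ℕ →₀ K)) m * z = - (z * CliffordAlgebra.ι (0 : QuadraticForm K (ℕ →₀ K)) m)) ?_ ?_ ?_ z hz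
  · intro b; rw [eq_neg_iff_add_eq_zero]; exact ExteriorAlgebra.ι_add_mul_swap m b
  · intro x y _ _ h1 h2; rw [mul_add, add_mul, h1, h2, neg_add]
  · intro a b x _ h
    rw [← mul_assoc, even_comm_ι _ (ι_mul_ι_mem_evenOdd_zero _ a b) m, mul_assoc, h, mul_neg, ← mul_assoc]

lemma odd_anti (z t : GrassmannAlg K) (hz : z ∈ evenOdd (0 : QuadraticForm K (ℕ →₀ K)) 1)
    (ht : t ∈ evenOdd (0 : QuadraticForm K (ℕ →₀ K)) 1) : t * z = - (z * t) := by
  refine CliffordAlgebra.odd_induction (0 : QuadraticForm K (ℕ →₀ K)) (P := fun t _ => t * z = - (z * t)) ?_ ?_ ?_ t ht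
  · intro b; exact odd_anti_ι z hz b
  · intro x y _ _ h1 h2; rw [mul_add, add_mul, h1, h2, neg_add]
  · intro a b x _ h
    rw [mul_assoc, h, mul_neg, ← mul_assoc, ← even_comm _ (ι_mul_ι_mem_evenOdd_zero _ a b) z, mul_assoc]

lemma odd_sq [CharZero K] (z : GrassmannAlg K) (hz : z ∈ evenOdd (0 : QuadraticForm K (ℕ →₀ K)) 1) : z * z = 0 := by
  have h := odd_anti z z hz hz
  have : (2:K) • (z * z) = 0 := by rw [two_smul]; nth_rewrite 1 [h]; simp
  rcases smul_eq_zero.mp this with h | h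
  · exact absurd h two_ne_zero
  · exact h

/-- determinant functionals -/
def detFun (K : Type*) [Field K] : ∀ i, (ℕ →₀ K) [⋀^Fin i]→ₗ[K] K
  | 2 => (Matrix.detRowAlternating (R := K) (n := Fin 2)).compLinearMap (LinearMap.pi (fun i : Fin 2 => Finsupp.lapply (i : ℕ)))
  | _ => 0

lemma gh_ne : ExteriorAlgebra.ι K (Finsupp.single 0 1 : ℕ →₀ K) * ExteriorAlgebra.ι K (Finsupp.single 1 1 : ℕ →₀ K) ≠ 0 := by
  intro h
  have e := ExteriorAlgebra.liftAlternating_apply_ιMulti (detFun K) ![(Finsupp.single 0 1 : ℕ →₀ K), Finsupp.single 1 1]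
  rw [ExteriorAlgebra.ιMulti_apply] at e
  simp only [List.ofFn_succ, List.ofFn_zero, List.prod_cons, List.prod_nil, mul_one] at e
  simp only [Matrix.cons_val_zero, Matrix.cons_val_one, Fin.succ_zero_eq_one] at e
  rw [h] at e
  have e2 : detFun K 2 ![(Finsupp.single 0 1 : ℕ →₀ K), Finsupp.single 1 1] =
    Matrix.det (Matrix.of fun i j : Fin 2 => (![(Finsupp.single 0 1 : ℕ →₀ K), Finsupp.single 1 1] i) (j : ℕ)) := rfl
  rw [map_zero, e2, Matrix.det_fin_two] at e
  simp at e

lemma id_M11 {E : Type*} [Ring E] (a b c d e f g h : E)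
    (ca : ∀ t, t * a = a * t) (cb : ∀ t, t * b = b * t) (cc : ∀ t, t * c = c * t) (cd : ∀ t, t * d = d * t)
    (ee : e * e = 0) (ff : f * f = 0) (gg : g * g = 0) (hh : h * h = 0)
    (fe : f * e = -(e * f)) (ge : g * e = -(e * g)) (he : h * e = -(e * h))
    (gf : g * f = -(f * g)) (hf : h * f = -(f * h)) (hg : h * g = -(g * h)) :
    br (br (!![a, e; f, b]) (!![c, g; h, d]) ^ 2) !![a, e; f, b] = 0 ∧ br (!![a, e; f, b]) (!![c, g; h, d]) ^ 3 = 0 := by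
  obtain ⟨α, hα⟩ : ∃ α, α = a - b := ⟨_, rfl⟩
  obtain ⟨γ, hγ⟩ : ∃ γ, γ = c - d := ⟨_, rfl⟩
  have cα : ∀ t, t * α = α * t := fun t => by rw [hα, mul_sub, sub_mul, ca, cb]
  have cγ : ∀ t, t * γ = γ * t := fun t => by rw [hγ, mul_sub, sub_mul, cc, cd]
  have hw : br (!![a, e; f, b]) (!![c, g; h, d]) =
      !![e * h + f * g, α * g - γ * e; γ * f - α * h, e * h + f * g] := by
    unfold br
    ext i j
    fin_cases i <;> fin_cases j <;> simp [Matrix.mul_apply, Fin.sum_univ_two]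
    · rw [ca c, gf]; abel
    · rw [cd e, cb g, hα, hγ]; noncomm_ring
    · rw [cc f, ca h, hα, hγ]; noncomm_ring
    · rw [cb d, he]; abel
  have hx : !![a, e; f, b] = !![b, 0; 0, b] + !![α, e; f, 0] := by
    rw [hα]; ext i j; fin_cases i <;> fin_cases j <;> simp
  have l {p q r : E} (k : p * q = -r) (t : E) : p * (q * t) = - (r * t) := by rw [← mul_assoc, k, neg_mul]
  have l0 {p : E} (k : p * p = 0) (t : E) : p * (p * t) = 0 := by rw [← mul_assoc, k, zero_mul]
  have l1 {p q : E} (k : ∀ t, t * q = q * t) (t : E) : p * (q * t) = q * (p * t) := by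
    rw [← mul_assoc, k, mul_assoc]
  rw [hw]
  constructor
  · have : br (!![e * h + f * g, α * g - γ * e; γ * f - α * h, e * h + f * g] ^ 2) !![a, e; f, b]
     = br (!![e * h + f * g, α * g - γ * e; γ * f - α * h, e * h + f * g] ^ 2) !![α, e; f, 0] := by
      rw [hx]; unfold br
      rw [mul_add, add_mul, add_sub_add_comm, add_eq_right, sub_eq_zero]
      ext i j; fin_cases i <;> fin_cases j <;> simp [Matrix.mul_apply, Fin.sum_univ_two, cb]
    rw [this]
    unfold br
    ext i j
    fin_cases i <;> fin_cases j <;> simp [pow_two, Matrix.mul_apply, Fin.sum_univ_two, mul_add, add_mul, mul_sub, sub_mul, mul_assoc,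
      cα e, cα f, cα g, cα h, cγ e, cγ f, cγ g, cγ h, cγ α, l1 cα (p := e), l1 cα (p := f), l1 cα (p := g), l1 cα (p := h), l1 cγ (p := e), l1 cγ (p := f), l1 cγ (p := g), l1 cγ (p := h), l1 cγ (p := α),
      ee, ff, gg, hh, l0 ee, l0 ff, l0 gg, l0 hh, fe, ge, he, gf, hf, hg, l fe, l ge, l he, l gf, l hf, l hg] <;> abel
  · ext i j
    fin_cases i <;> fin_cases j <;> simp [pow_succ, Matrix.mul_apply, Fin.sum_univ_two, mul_add, add_mul, mul_sub, sub_mul, mul_assoc,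
      cα e, cα f, cα g, cα h, cγ e, cγ f, cγ g, cγ h, cγ α, l1 cα (p := e), l1 cα (p := f), l1 cα (p := g), l1 cα (p := h), l1 cγ (p := e), l1 cγ (p := f), l1 cγ (p := g), l1 cγ (p := h), l1 cγ (p := α),
      ee, ff, gg, hh, l0 ee, l0 ff, l0 gg, l0 hh, fe, ge, he, gf, hf, hg, l fe, l ge, l he, l gf, l hf, l hg] <;> abel
end G

section Final
variable {K : Type*} [Field K] [CharZero K]

lemma M11_id (X Y : M11 K) : br (br X Y ^ 2) X = 0 ∧ br X Y ^ 3 = 0 := by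
  obtain ⟨X, x1, x2, x3, x4⟩ := X
  obtain ⟨Y, y1, y2, y3, y4⟩ := Y
  have := id_M11 (X 0 0) (X 1 1) (Y 0 0) (Y 1 1) (X 0 1) (X 1 0) (Y 0 1) (Y 1 0)
    (even_comm _ x1) (even_comm _ x2) (even_comm _ y1) (even_comm _ y2)
    (odd_sq _ x3) (odd_sq _ x4) (odd_sq _ y3) (odd_sq _ y4)
    (odd_anti _ _ x3 x4) (odd_anti _ _ x3 y3) (odd_anti _ _ x3 y4)
    (odd_anti _ _ x4 y3) (odd_anti _ _ x4 y4) (odd_anti _ _ y3 y4)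
  rw [← Matrix.eta_fin_two X, ← Matrix.eta_fin_two Y] at this
  exact ⟨Subtype.ext this.1, Subtype.ext this.2⟩

omit [CharZero K] in
lemma map_br {A B : Type*} [Ring A] [Ring B] [Algebra K A] [Algebra K B] (φ : A →ₐ[K] B) (a b : A) :
    φ (br a b) = br (φ a) (φ b) := by simp [br]

lemma T_le (f : FreeAlgebra K (Fin 2)) (hf : f ∈ TIdealGen₂ K {br (br (xvar K) (yvar K) ^ 2) (xvar K),
          br (xvar K) (yvar K) ^ 3}) : f ∈ polyIdentities₂ K (M11 K) := by
  intro φ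
  have : TIdealGen₂ K {br (br (xvar K) (yvar K) ^ 2) (xvar K),
          br (xvar K) (yvar K) ^ 3} ≤ TwoSidedIdeal.ker φ := by
    refine TwoSidedIdeal.span_le.mpr ?_
    rintro _ ⟨f, (rfl | rfl), ψ, rfl⟩
    · rw [SetLike.mem_coe, TwoSidedIdeal.mem_ker]
      simp only [map_br, map_pow]
      exact (M11_id _ _).1
    · rw [SetLike.mem_coe, TwoSidedIdeal.mem_ker]
      simp only [map_br, map_pow]
      exact (M11_id _ _).2
  exact (TwoSidedIdeal.mem_ker φ).mp (this hf)

lemma quot_hyp (T : TwoSidedIdeal (FreeAlgebra K (Fin 2)))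
    (hT : T = TIdealGen₂ K {br (br (xvar K) (yvar K) ^ 2) (xvar K), br (xvar K) (yvar K) ^ 3}) :
    Hyp_s17 K (T.ringCon.mkₐ (α := K) (xvar K)) (T.ringCon.mkₐ (α := K) (yvar K))
      (T.ringCon.mkₐ (α := K) (xvar K * yvar K - yvar K * xvar K)) := by
  set π := T.ringCon.mkₐ (α := K) with hπ
  have sur : Function.Surjective π := T.ringCon.mkₐ_surjective
  have ker (f : FreeAlgebra K (Fin 2)) (hf : f ∈ T) : π f = 0 := by
    have : T.ringCon f 0 := (TwoSidedIdeal.mem_iff T f).mp hf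
    have h2 : π f = π 0 := (RingCon.eq _).mpr this
    rw [h2, map_zero]
  refine ⟨?_, by simp, ?_, ?_⟩
  · intro S h1 hx hy p
    obtain ⟨f, rfl⟩ := sur p
    suffices h : ∀ s ∈ S, s * π f ∈ S by simpa using h 1 h1
    induction f using FreeAlgebra.induction with
    | grade0 r =>
      intro s hs
      rw [AlgHom.commutes, ← Algebra.commutes, ← Algebra.smul_def]
      exact S.smul_mem r hs
    | grade1 i =>
      fin_cases i
      · exact hx
      · exact hy
    | mul a b ha hb =>
      intro s hs
      rw [map_mul, ← mul_assoc]
      exact hb _ (ha _ hs)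
    | add a b ha hb =>
      intro s hs
      rw [map_add, mul_add]
      exact add_mem (ha _ hs) (hb _ hs)
  · intro a b
    obtain ⟨a, rfl⟩ := sur a
    obtain ⟨b, rfl⟩ := sur b
    have : br (br a b ^ 2) a ∈ T := by
      rw [hT]
      refine TwoSidedIdeal.subset_span ⟨_, Or.inl rfl, FreeAlgebra.lift K ![a, b], ?_⟩
      simp only [map_br, map_pow, xvar, yvar, FreeAlgebra.lift_ι_apply]
      rfl
    have := ker _ this
    simp only [map_br, map_pow, br] at this
    exact sub_eq_zero.mp this
  · have : br (xvar K) (yvar K) ^ 3 ∈ T := by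
      rw [hT]
      exact TwoSidedIdeal.subset_span ⟨_, Or.inr rfl, AlgHom.id K _, rfl⟩
    have := ker _ this
    rw [map_pow] at this
    exact this

lemma indep_s17 (P1 : MvPolynomial (Fin 2) K) (P2 P3 : MvPolynomial (Fin 4) K)
    (h : ∀ X Y : M11 K, L1 X Y P1 + L2 X Y P2 + L2 X Y P3 * (X * Y - Y * X) = 0) :
    P1 = 0 ∧ P2 = 0 ∧ P3 = 0 := by
  have p1 : P1 = 0 := by
    refine MvPolynomial.funext fun v => ?_
    have := h (algebraMap K _ (v 0)) (algebraMap K _ (v 1))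
    rw [(scalar_L (A := M11 K) (v 0) (v 1) P1 P2).1, (scalar_L (A := M11 K) (v 0) (v 1) P1 P2).2,
      (scalar_L (A := M11 K) (v 0) (v 1) P1 P3).2, zero_mul, add_zero, add_zero] at this
    have hv : ![v 0, v 1] = v := by ext i; fin_cases i <;> rfl
    rw [hv] at this
    rw [map_zero]
    exact (FaithfulSMul.algebraMap_injective K (M11 K)) (by rw [this, map_zero])
  subst p1
  simp only [map_zero, zero_add] at h
  let g : GrassmannAlg K := ExteriorAlgebra.ι K (Finsupp.single 0 1 : ℕ →₀ K)
  let k : GrassmannAlg K := ExteriorAlgebra.ι K (Finsupp.single 1 1 : ℕ →₀ K)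
  have og : g ∈ evenOdd (0 : QuadraticForm K (ℕ →₀ K)) 1 := ι_mem_evenOdd_one _ _
  have ok : k ∈ evenOdd (0 : QuadraticForm K (ℕ →₀ K)) 1 := ι_mem_evenOdd_one _ _
  have gg := odd_sq g og
  have kk := odd_sq k ok
  have kg := odd_anti g k og ok
  have gk0 : g * k ≠ 0 := gh_ne
  have g0 : g ≠ 0 := fun h => gk0 (by rw [h, zero_mul])
  have ev (a : K) : (a • 1 : GrassmannAlg K) ∈ evenOdd (0 : QuadraticForm K (ℕ →₀ K)) 0 :=
    Submodule.smul_mem _ _ (SetLike.one_mem_graded _)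
  have main (a b c d : K) : L2 (K := K) (!![a • 1, 0; 0, b • 1] : Matrix (Fin 2) (Fin 2) (GrassmannAlg K)) !![c • 1, g; k, d • 1] P2
      + L2 (K := K) (!![a • 1, 0; 0, b • 1] : Matrix (Fin 2) (Fin 2) (GrassmannAlg K)) !![c • 1, g; k, d • 1] P3 *
        !![0, (a - b) • g; -((a - b) • k), 0] = 0 := by
    have := h ⟨!![a • 1, 0; 0, b • 1], ev a, ev b, zero_mem _, zero_mem _⟩
      ⟨!![c • 1, g; k, d • 1], ev c, ev d, og, ok⟩
    have := congrArg (M11 K).val this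
    rw [map_add, map_mul, map_sub, map_mul, map_mul, L2_map, L2_map, map_zero] at this
    rw [← model_w a b c d]
    exact this
  have canc (P : MvPolynomial (Fin 4) K) (hP : ∀ a b c d : K, (a - b) * MvPolynomial.eval ![a, c, b, d] P = 0) : P = 0 := by
    have : (MvPolynomial.X 0 - MvPolynomial.X 2) * P = 0 := by
      refine MvPolynomial.funext fun v => ?_
      have hv : ![v 0, v 1, v 2, v 3] = v := by ext i; fin_cases i <;> rfl
      have := hP (v 0) (v 2) (v 1) (v 3)
      rw [hv] at this
      simpa using this
    rcases mul_eq_zero.mp this with h | h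
    · exfalso
      have := MvPolynomial.X_injective (sub_eq_zero.mp h)
      exact absurd this (by decide)
    · exact h
  have p2 : P2 = 0 := by
    refine canc _ fun a b c d => ?_
    have m2 := model_L2 (K := K) a b c d gg kk kg P2
    have m3 := model_L2 (K := K) a b c d gg kk kg P3
    have := congrFun (congrFun (main a b c d) 0) 1
    rw [Matrix.add_apply, Matrix.mul_apply, Fin.sum_univ_two, m2.1] at this
    simp only [Matrix.of_apply, Matrix.cons_val', Matrix.cons_val_zero, Matrix.cons_val_one,
      mul_zero, add_zero, mul_smul_comm, m3.2, smul_zero, Matrix.zero_apply, Matrix.cons_val_fin_one] at this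
    exact (smul_eq_zero.mp this).resolve_right g0
  refine ⟨rfl, p2, ?_⟩
  subst p2
  refine canc _ fun a b c d => ?_
  have m3 := model_L2 (K := K) a b c d gg kk kg P3
  have := congrFun (congrFun (main a b c d) 0) 0
  rw [Matrix.add_apply, Matrix.mul_apply, Fin.sum_univ_two, m3.1] at this
  simp [smul_smul] at this
  rcases this with (h | h) | h
  · rw [h, zero_mul]
  · rw [h, mul_zero]
  · exact absurd h gk0

end Final

/- STATEMENT 17: the polynomial identities of M11(E) in two variables form exactly the T-ideal
of K⟨x,y⟩ generated by h = [[x,y]^2, x] and d = [x,y]^3. -/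
theorem stmt17 (K : Type*) [Field K] [CharZero K] :
    polyIdentities₂ K (M11 K) =
      (TIdealGen₂ K {br (br (xvar K) (yvar K) ^ 2) (xvar K),
          br (xvar K) (yvar K) ^ 3} : Set (FreeAlgebra K (Fin 2))) := by
  refine Set.Subset.antisymm ?_ (fun f hf => T_le f hf)
  intro f hf
  obtain ⟨T, hT⟩ : ∃ T, T = TIdealGen₂ K {br (br (xvar K) (yvar K) ^ 2) (xvar K),
          br (xvar K) (yvar K) ^ 3} := ⟨_, rfl⟩
  rw [← hT]
  obtain ⟨P1, P2, P3, hP⟩ := (quot_hyp T hT).normal (T.ringCon.mkₐ (α := K) f)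
  rw [← L1_map, ← L2_map, ← L2_map, ← map_mul, ← map_add, ← map_add] at hP
  have hT' : f - (L1 (xvar K) (yvar K) P1 + L2 (xvar K) (yvar K) P2 +
      L2 (xvar K) (yvar K) P3 * (xvar K * yvar K - yvar K * xvar K)) ∈ T := by
    have : T.ringCon f _ := (RingCon.eq _).mp hP
    exact (TwoSidedIdeal.rel_iff T _ _).mp this
  have hz := indep_s17 P1 P2 P3 (by
    intro X Y
    let φ : FreeAlgebra K (Fin 2) →ₐ[K] M11 K := FreeAlgebra.lift K ![X, Y]
    have hx : φ (xvar K) = X := by simp [φ, xvar]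
    have hy : φ (yvar K) = Y := by simp [φ, yvar]
    have h1 := T_le _ (hT ▸ hT') φ
    rw [map_sub, hf φ, zero_sub, neg_eq_zero] at h1
    rw [map_add, map_add, map_mul, map_sub, map_mul, map_mul, L1_map, L2_map, L2_map, hx, hy] at h1
    exact h1)
  obtain ⟨rfl, rfl, rfl⟩ := hz
  simpa using hT'
end
end
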